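/- Let Σ_Λ = {Σ_λ = (γ_λ,f_λ,g_λ)}_{λ∈Λ} and h⁰, h ∈ H satisfy Assumption 1 with φ_λ(t,r) = p(t)·φ̄(r) for all λ ∈ Λ, where p : [0,∞) → [0,∞) is locally integrable and φ̄ is continuous, and with α_λ(t,r) = ᾱ(r) for all λ ∈ Λ, where ᾱ is continuous and positive definite. Suppose φ̄ is positive definite and there exists a constant θ > 0 such that γ_λ ∈ Γ_θ for all λ ∈ Λ and sup_{a>0} ∫_a^{ᾱ(a)} ds/φ̄(s) < inf_{t≥0} ∫_t^{t+θ} p(s) ds =: M, with M > 0. Then Σ_Λ is strongly (h⁰,h)-ISS. -/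

import Mathlib

open MeasureTheory Filter Set
open scoped Classical

noncomputable section

/-- State/input spaces: `ℝ^k` with the Euclidean norm. -/
abbrev Stt (k : ℕ) : Type := EuclideanSpace ℝ (Fin k)

/-- An impulse-time sequence, identified with its (locally finite) set of impulse
times, a subset of `(0,∞)` with finitely many points below any bound. -/
def IsImpulseSeq (γ : Set ℝ) : Prop :=
  γ ⊆ Set.Ioi (0 : ℝ) ∧ ∀ T : ℝ, (γ ∩ Set.Iic T).Finite

/-- `n^γ_{(s,t]}`: the number of impulse times in the interval `(s,t]`. -/
def nJumps (γ : Set ℝ) (s t : ℝ) : ℕ := (γ ∩ Set.Ioc s t).ncard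

/-- Uniform incremental boundedness of a set of impulse-time sequences. -/
def UIB (S : Set (Set ℝ)) : Prop :=
  ∃ φ : ℝ → ℝ, ContinuousOn φ (Set.Ici 0) ∧ MonotoneOn φ (Set.Ici 0) ∧
    (∀ s : ℝ, 0 ≤ s → 0 ≤ φ s) ∧
    ∀ γ ∈ S, ∀ t0 t : ℝ, 0 ≤ t0 → t0 < t → (nJumps γ t0 t : ℝ) ≤ φ (t - t0)

/-- Class `K∞` functions `[0,∞) → [0,∞)`. -/
def ClassKInf (α : ℝ → ℝ) : Prop :=
  ContinuousOn α (Set.Ici 0) ∧ StrictMonoOn α (Set.Ici 0) ∧ α 0 = 0 ∧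
    ∀ M : ℝ, ∃ r : ℝ, 0 ≤ r ∧ M ≤ α r

/-- Class `KL` functions. -/
def ClassKL (β : ℝ → ℝ → ℝ) : Prop :=
  (∀ t : ℝ, 0 ≤ t → ClassKInf fun r => β r t) ∧
  ∀ r : ℝ, 0 ≤ r → AntitoneOn (fun t => β r t) (Set.Ici 0) ∧
    Filter.Tendsto (fun t => β r t) Filter.atTop (nhds 0)

/-- Positive definite functions `[0,∞) → [0,∞)`. -/
def PosDef (ρ : ℝ → ℝ) : Prop :=
  ContinuousOn ρ (Set.Ici 0) ∧ ρ 0 = 0 ∧ ∀ r : ℝ, 0 < r → 0 < ρ r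

/-- Locally integrable (on compacts) function `[0,∞) → ℝ` (extended to `ℝ`). -/
def LocIntegrable (p : ℝ → ℝ) : Prop :=
  ∀ a b : ℝ, MeasureTheory.IntegrableOn p (Set.Icc a b)

/-- Inputs: measurable, locally essentially bounded functions. -/
def IsInput {m : ℕ} (u : ℝ → Stt m) : Prop :=
  Measurable u ∧ ∀ T : ℝ, ∃ C : ℝ, ∀ᵐ t ∂MeasureTheory.volume, t ∈ Set.Icc 0 T → ‖u t‖ ≤ C

/-- `‖u_I‖_γ`: max of the essential supremum of `‖u‖` over `I` and the supremum of
`‖u‖` over `γ ∩ I`. -/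
def inputNorm {m : ℕ} (γ : Set ℝ) (u : ℝ → Stt m) (I : Set ℝ) : ℝ :=
  max (essSup (fun t => ‖u t‖) (MeasureTheory.volume.restrict I))
      (sSup ((fun t => ‖u t‖) '' (γ ∩ I)))

/-- Solution of the impulsive system `(γ,f,g)` on `[t0,T)` with initial state `x0`
and input `u` (Carathéodory solutions, in integral form, between impulses). -/
structure IsSolution {n m : ℕ} (γ : Set ℝ) (f g : ℝ → Stt n → Stt m → Stt n)
    (t0 : ℝ) (x0 : Stt n) (u : ℝ → Stt m) (T : EReal) (x : ℝ → Stt n) : Prop where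
  lt : (t0 : EReal) < T
  init : x t0 = x0
  flow : ∀ t1 t2 : ℝ, t0 ≤ t1 → t1 ≤ t2 → (t2 : EReal) < T → Set.Ioc t1 t2 ∩ γ = ∅ →
    MeasureTheory.IntegrableOn (fun s => f s (x s) (u s)) (Set.Icc t1 t2) ∧
    x t2 = x t1 + ∫ s in t1..t2, f s (x s) (u s)
  jump : ∀ t ∈ γ, t0 < t → (t : EReal) < T →
    ∃ L : Stt n, Filter.Tendsto x (nhdsWithin t (Set.Iio t)) (nhds L) ∧
      x t = L + g t L (u t)

/-- Maximally defined solution. -/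
def IsMaxSolution {n m : ℕ} (γ : Set ℝ) (f g : ℝ → Stt n → Stt m → Stt n)
    (t0 : ℝ) (x0 : Stt n) (u : ℝ → Stt m) (T : EReal) (x : ℝ → Stt n) : Prop :=
  IsSolution γ f g t0 x0 u T x ∧
    ∀ (T' : EReal) (x' : ℝ → Stt n), IsSolution γ f g t0 x0 u T' x' →
      (∀ t : ℝ, t0 ≤ t → (t : EReal) < T → x' t = x t) → T' ≤ T

/-- Weak `(h⁰,h)`-ISS of a parametrized family of impulsive systems. -/
def WeaklyISS {n m : ℕ} {Λ : Type*} (γ : Λ → Set ℝ)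
    (f g : Λ → ℝ → Stt n → Stt m → Stt n) (h0 h : ℝ → Stt n → ℝ) : Prop :=
  ∃ β : ℝ → ℝ → ℝ, ∃ ρ : ℝ → ℝ, ClassKL β ∧ ClassKInf ρ ∧
    ∀ (l : Λ) (t0 : ℝ) (x0 : Stt n) (u : ℝ → Stt m) (T : EReal) (x : ℝ → Stt n),
      0 ≤ t0 → IsInput u → IsMaxSolution (γ l) (f l) (g l) t0 x0 u T x →
      ∀ t : ℝ, t0 ≤ t → (t : EReal) < T →
        h t (x t) ≤ β (h0 t0 x0) (t - t0) + ρ (inputNorm (γ l) u (Set.Ioc t0 t))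

/-- Strong `(h⁰,h)`-ISS of a parametrized family of impulsive systems. -/
def StronglyISS {n m : ℕ} {Λ : Type*} (γ : Λ → Set ℝ)
    (f g : Λ → ℝ → Stt n → Stt m → Stt n) (h0 h : ℝ → Stt n → ℝ) : Prop :=
  ∃ β : ℝ → ℝ → ℝ, ∃ ρ : ℝ → ℝ, ClassKL β ∧ ClassKInf ρ ∧
    ∀ (l : Λ) (t0 : ℝ) (x0 : Stt n) (u : ℝ → Stt m) (T : EReal) (x : ℝ → Stt n),
      0 ≤ t0 → IsInput u → IsMaxSolution (γ l) (f l) (g l) t0 x0 u T x →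
      ∀ t : ℝ, t0 ≤ t → (t : EReal) < T →
        h t (x t) ≤ β (h0 t0 x0) (t - t0 + (nJumps (γ l) t0 t : ℝ)) +
          ρ (inputNorm (γ l) u (Set.Ioc t0 t))

/-- Locally Lipschitz on a set. -/
def LocLipschitzOn {α β : Type*} [PseudoEMetricSpace α] [PseudoEMetricSpace β]
    (s : Set α) (f : α → β) : Prop :=
  ∀ x ∈ s, ∃ K : NNReal, ∃ t ∈ nhdsWithin x s, LipschitzOnWith K f t

/-- `V ∈ V(γ)` with `Vm` its left-limit function at impulse times: `V` is locally
Lipschitz on each inter-impulse strip and has the joint left limit `Vm τ ξ`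
at each `τ ∈ γ`. -/
def InClassV {n : ℕ} (γ : Set ℝ) (V Vm : ℝ → Stt n → ℝ) : Prop :=
  (∀ a b : ℝ, 0 ≤ a → Set.Ioo a b ∩ γ = ∅ →
    LocLipschitzOn (Set.Ico a b ×ˢ (Set.univ : Set (Stt n)))
      (fun q : ℝ × Stt n => V q.1 q.2)) ∧
  ∀ τ ∈ γ, ∀ ξ : Stt n,
    Filter.Tendsto (fun q : ℝ × Stt n => V q.1 q.2)
      (nhdsWithin (τ, ξ) (Set.Iio τ ×ˢ (Set.univ : Set (Stt n)))) (nhds (Vm τ ξ))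

/-- Upper-right Dini derivative of `V` along the flow map `f`. -/
def DiniAlong {n m : ℕ} (f : ℝ → Stt n → Stt m → Stt n) (V : ℝ → Stt n → ℝ)
    (t : ℝ) (ξ : Stt n) (μ : Stt m) : ℝ :=
  Filter.limsup (fun d : ℝ => (V (t + d) (ξ + d • f t ξ μ) - V t ξ) / d)
    (nhdsWithin 0 (Set.Ioi 0))

/-- Carathéodory function `[0,∞) × [0,∞) → ℝ`. -/
def Caratheodory2 (φ : ℝ → ℝ → ℝ) : Prop :=
  (∀ r : ℝ, Measurable fun t => φ t r) ∧
  (∀ t : ℝ, ContinuousOn (φ t) (Set.Ici 0)) ∧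
  ∀ a b c : ℝ, ∃ mK : ℝ → ℝ, MeasureTheory.IntegrableOn mK (Set.Icc a b) ∧
    ∀ t ∈ Set.Icc a b, ∀ r ∈ Set.Icc (0 : ℝ) c, |φ t r| ≤ mK t

/-- Assumption 1 of the paper, with all the data explicit. -/
def Assumption1 {n m : ℕ} {Λ : Type*} (γ : Λ → Set ℝ)
    (f g : Λ → ℝ → Stt n → Stt m → Stt n) (h0 h : ℝ → Stt n → ℝ)
    (V Vm : Λ → ℝ → Stt n → ℝ) (φ1 φ2 χ π : ℝ → ℝ)
    (vφ al : Λ → ℝ → ℝ → ℝ) : Prop :=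
  ClassKInf φ1 ∧ ClassKInf φ2 ∧ ClassKInf χ ∧ ClassKInf π ∧
  (∀ l : Λ, InClassV (γ l) (V l) (Vm l)) ∧
  (∀ l : Λ, Caratheodory2 (vφ l)) ∧
  (∀ (l : Λ) (t r : ℝ), 0 ≤ t → 0 ≤ r → 0 ≤ al l t r) ∧
  (∀ (l : Λ) (t : ℝ) (ξ : Stt n), 0 ≤ t →
    φ1 (h t ξ) ≤ V l t ξ ∧ V l t ξ ≤ φ2 (h0 t ξ)) ∧
  (∀ (l : Λ) (t : ℝ) (ξ : Stt n) (μ : Stt m), 0 ≤ t → t ∉ γ l → χ ‖μ‖ ≤ V l t ξ →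
    DiniAlong (f l) (V l) t ξ μ ≤ - vφ l t (V l t ξ)) ∧
  (∀ (l : Λ) (t : ℝ) (ξ : Stt n) (μ : Stt m), t ∈ γ l → χ ‖μ‖ ≤ Vm l t ξ →
    V l t (ξ + g l t ξ μ) ≤ al l t (Vm l t ξ)) ∧
  (∀ (l : Λ) (t : ℝ) (ξ : Stt n) (μ : Stt m), t ∈ γ l → Vm l t ξ ≤ χ ‖μ‖ →
    V l t (ξ + g l t ξ μ) ≤ π ‖μ‖)

/-- Solution of the scalar comparison differential/difference inclusion. -/
structure IsCompSol (γ : Set ℝ) (vφ al : ℝ → ℝ → ℝ) (t0 z0 : ℝ) (T : EReal)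
    (z : ℝ → ℝ) : Prop where
  lt : (t0 : EReal) < T
  init : z t0 = z0
  nonneg : ∀ t : ℝ, t0 ≤ t → (t : EReal) < T → 0 ≤ z t
  flow : ∀ t1 t2 : ℝ, t0 ≤ t1 → t1 ≤ t2 → (t2 : EReal) < T → Set.Ioc t1 t2 ∩ γ = ∅ →
    ∃ d : ℝ → ℝ, MeasureTheory.IntegrableOn d (Set.Icc t1 t2) ∧
      (∀ᵐ s ∂MeasureTheory.volume, s ∈ Set.Icc t1 t2 → d s ≤ - vφ s (z s)) ∧
      ∀ t ∈ Set.Icc t1 t2, z t = z t1 + ∫ s in t1..t, d s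
  jump : ∀ t ∈ γ, t0 < t → (t : EReal) < T →
    ∃ L : ℝ, Filter.Tendsto z (nhdsWithin t (Set.Iio t)) (nhds L) ∧ z t ≤ al t L

/-- The family of comparison systems is weakly GUAS. -/
def CompWeakGUAS {Λ : Type*} (γ : Λ → Set ℝ) (vφ al : Λ → ℝ → ℝ → ℝ) : Prop :=
  ∃ β : ℝ → ℝ → ℝ, ClassKL β ∧
    ∀ (l : Λ) (t0 z0 : ℝ) (T : EReal) (z : ℝ → ℝ), 0 ≤ t0 → 0 ≤ z0 →
      IsCompSol (γ l) (vφ l) (al l) t0 z0 T z →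
      ∀ t : ℝ, t0 ≤ t → (t : EReal) < T → z t ≤ β z0 (t - t0)

/-- The family of comparison systems is strongly GUAS. -/
def CompStrongGUAS {Λ : Type*} (γ : Λ → Set ℝ) (vφ al : Λ → ℝ → ℝ → ℝ) : Prop :=
  ∃ β : ℝ → ℝ → ℝ, ClassKL β ∧
    ∀ (l : Λ) (t0 z0 : ℝ) (T : EReal) (z : ℝ → ℝ), 0 ≤ t0 → 0 ≤ z0 →
      IsCompSol (γ l) (vφ l) (al l) t0 z0 T z →
      ∀ t : ℝ, t0 ≤ t → (t : EReal) < T → z t ≤ β z0 (t - t0 + (nJumps (γ l) t0 t : ℝ))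

/-- Nonnegative Carathéodory solution of the scalar ODE `ẇ = rhs(t,w)` on `[t0,T)`. -/
structure IsODESol (rhs : ℝ → ℝ → ℝ) (t0 : ℝ) (T : EReal) (w : ℝ → ℝ) : Prop where
  lt : (t0 : EReal) < T
  nonneg : ∀ t : ℝ, t0 ≤ t → (t : EReal) < T → 0 ≤ w t
  flow : ∀ t1 t2 : ℝ, t0 ≤ t1 → t1 ≤ t2 → (t2 : EReal) < T →
    IntervalIntegrable (fun s => rhs s (w s)) MeasureTheory.volume t1 t2 ∧
    w t2 = w t1 + ∫ s in t1..t2, rhs s (w s)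

/-- Maximally defined forward-in-time solution of `ẇ = rhs(t,w)`. -/
def IsMaxODESol (rhs : ℝ → ℝ → ℝ) (t0 : ℝ) (T : EReal) (w : ℝ → ℝ) : Prop :=
  IsODESol rhs t0 T w ∧
    ∀ (T' : EReal) (w' : ℝ → ℝ), IsODESol rhs t0 T' w' →
      (∀ t : ℝ, t0 ≤ t → (t : EReal) < T → w' t = w t) → T' ≤ T

/-- GUAS of the family of scalar ODEs `ẇ = −φ_λ(t,w)`. -/
def ODEFamilyGUAS {Λ : Type*} (vφ : Λ → ℝ → ℝ → ℝ) : Prop :=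
  ∃ β : ℝ → ℝ → ℝ, ClassKL β ∧
    ∀ (l : Λ) (t0 : ℝ) (T : EReal) (w : ℝ → ℝ), 0 ≤ t0 →
      IsMaxODESol (fun s r => -(vφ l s r)) t0 T w →
      T = (⊤ : EReal) ∧ ∀ t : ℝ, t0 ≤ t → w t ≤ β (w t0) (t - t0)

/-- Solution (on all of `[0,∞)`) of the scalar linear ODE `ẇ = −p(t)·w`. -/
def IsLinSol (p : ℝ → ℝ) (w : ℝ → ℝ) : Prop :=
  ∀ t1 t2 : ℝ, 0 ≤ t1 → t1 ≤ t2 →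
    IntervalIntegrable (fun s => p s * w s) MeasureTheory.volume t1 t2 ∧
    w t2 = w t1 + ∫ s in t1..t2, -(p s * w s)

/-- An impulsive and switching sequence, described through its impulse-time set,
its two switching signals (constant between impulses), and the left limit of the
first switching signal at impulse times. -/
structure SwSignal (Ic Id : Type*) where
  γ : Set ℝ
  σ1 : ℝ → Ic
  σ1m : ℝ → Ic
  σ2 : ℝ → Id
  impulse : IsImpulseSeq γ
  const1 : ∀ a b : ℝ, 0 ≤ a → Set.Ioo a b ∩ γ = ∅ → ∀ t ∈ Set.Ico a b, σ1 t = σ1 a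
  const2 : ∀ a b : ℝ, 0 ≤ a → Set.Ioo a b ∩ γ = ∅ → ∀ t ∈ Set.Ico a b, σ2 t = σ2 a
  leftlim : ∀ t ∈ γ, ∀ᶠ s in nhdsWithin t (Set.Iio t), σ1 s = σ1m t

/-- `σ ∈ SW(J)`. -/
def InSW {Ic Id : Type*} (σ : SwSignal Ic Id) (J : Set (Ic × Ic × Id)) : Prop :=
  ∀ t ∈ σ.γ, (σ.σ1m t, σ.σ1 t, σ.σ2 t) ∈ J

/-- Flow map of the switched impulsive system `Σ_σ`. -/
def swF {n m : ℕ} {Ic Id : Type*} (F : Ic → ℝ → Stt n → Stt m → Stt n)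
    (σ : SwSignal Ic Id) : ℝ → Stt n → Stt m → Stt n :=
  fun t ξ μ => F (σ.σ1 t) t ξ μ

/-- Jump map of the switched impulsive system `Σ_σ`. -/
def swG {n m : ℕ} {Ic Id : Type*} (G : Id → ℝ → Stt n → Stt m → Stt n)
    (σ : SwSignal Ic Id) : ℝ → Stt n → Stt m → Stt n :=
  fun t ξ μ => G (σ.σ2 t) t ξ μ

/-- Weak `(h⁰,h)`-ISS of the family `{Σ_σ}_{σ ∈ SW}`. -/
def SwWeaklyISS {n m : ℕ} {Ic Id : Type*} (F : Ic → ℝ → Stt n → Stt m → Stt n)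
    (G : Id → ℝ → Stt n → Stt m → Stt n) (SW : Set (SwSignal Ic Id))
    (h0 h : ℝ → Stt n → ℝ) : Prop :=
  ∃ β : ℝ → ℝ → ℝ, ∃ ρ : ℝ → ℝ, ClassKL β ∧ ClassKInf ρ ∧
    ∀ σ ∈ SW, ∀ (t0 : ℝ) (x0 : Stt n) (u : ℝ → Stt m) (T : EReal) (x : ℝ → Stt n),
      0 ≤ t0 → IsInput u → IsMaxSolution σ.γ (swF F σ) (swG G σ) t0 x0 u T x →
      ∀ t : ℝ, t0 ≤ t → (t : EReal) < T →
        h t (x t) ≤ β (h0 t0 x0) (t - t0) + ρ (inputNorm σ.γ u (Set.Ioc t0 t))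

/-- Strong `(h⁰,h)`-ISS of the family `{Σ_σ}_{σ ∈ SW}`. -/
def SwStronglyISS {n m : ℕ} {Ic Id : Type*} (F : Ic → ℝ → Stt n → Stt m → Stt n)
    (G : Id → ℝ → Stt n → Stt m → Stt n) (SW : Set (SwSignal Ic Id))
    (h0 h : ℝ → Stt n → ℝ) : Prop :=
  ∃ β : ℝ → ℝ → ℝ, ∃ ρ : ℝ → ℝ, ClassKL β ∧ ClassKInf ρ ∧
    ∀ σ ∈ SW, ∀ (t0 : ℝ) (x0 : Stt n) (u : ℝ → Stt m) (T : EReal) (x : ℝ → Stt n),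
      0 ≤ t0 → IsInput u → IsMaxSolution σ.γ (swF F σ) (swG G σ) t0 x0 u T x →
      ∀ t : ℝ, t0 ≤ t → (t : EReal) < T →
        h t (x t) ≤ β (h0 t0 x0) (t - t0 + (nJumps σ.γ t0 t : ℝ)) +
          ρ (inputNorm σ.γ u (Set.Ioc t0 t))

/-- Total activation time in `(t0,t]` of the flow modes in `A`. -/
def actT {Ic Id : Type*} (σ : SwSignal Ic Id) (A : Set Ic) (t0 t : ℝ) : ℝ :=
  (MeasureTheory.volume {r : ℝ | r ∈ Set.Ioc t0 t ∧ σ.σ1 r ∈ A}).toReal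

/-- Number of impulse times in `(t0,t]` whose mode combination lies in `Jp`. -/
def nJumpsIn {Ic Id : Type*} (σ : SwSignal Ic Id) (Jp : Set (Ic × Ic × Id))
    (t0 t : ℝ) : ℕ :=
  (σ.γ ∩ Set.Ioc t0 t ∩ {r : ℝ | (σ.σ1m r, σ.σ1 r, σ.σ2 r) ∈ Jp}).ncard

/-- Assumption 2 of the paper (for switched impulsive systems), data explicit. -/
def Assumption2 {n m : ℕ} {Ic Id : Type*}
    (F : Ic → ℝ → Stt n → Stt m → Stt n) (G : Id → ℝ → Stt n → Stt m → Stt n)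
    (h0 h : ℝ → Stt n → ℝ) (J : Set (Ic × Ic × Id))
    (v : Ic → ℝ → Stt n → ℝ) (φ1 φ2 χ π : ℝ → ℝ)
    (vφ : Ic → ℝ → ℝ → ℝ) (al : Ic × Ic × Id → ℝ → ℝ → ℝ) : Prop :=
  ClassKInf φ1 ∧ ClassKInf φ2 ∧ ClassKInf χ ∧ ClassKInf π ∧
  (∀ i : Ic, LocLipschitzOn ((Set.Ici (0 : ℝ)) ×ˢ (Set.univ : Set (Stt n)))
      (fun q : ℝ × Stt n => v i q.1 q.2)) ∧
  (∀ i : Ic, Caratheodory2 (vφ i)) ∧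
  (∀ e ∈ J, ∀ t r : ℝ, 0 ≤ t → 0 ≤ r → 0 ≤ al e t r) ∧
  (∀ (i : Ic) (t : ℝ) (ξ : Stt n), 0 ≤ t →
    φ1 (h t ξ) ≤ v i t ξ ∧ v i t ξ ≤ φ2 (h0 t ξ)) ∧
  (∀ (i : Ic) (t : ℝ) (ξ : Stt n) (μ : Stt m), 0 ≤ t → χ ‖μ‖ ≤ v i t ξ →
    DiniAlong (F i) (v i) t ξ μ ≤ - vφ i t (v i t ξ)) ∧
  (∀ (ι i : Ic) (j : Id), (ι, i, j) ∈ J → ∀ (t : ℝ) (ξ : Stt n) (μ : Stt m),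
    0 ≤ t → χ ‖μ‖ ≤ v ι t ξ → v i t (ξ + G j t ξ μ) ≤ al (ι, i, j) t (v ι t ξ)) ∧
  (∀ (ι i : Ic) (j : Id), (ι, i, j) ∈ J → ∀ (t : ℝ) (ξ : Stt n) (μ : Stt m),
    0 ≤ t → v ι t ξ ≤ χ ‖μ‖ → v i t (ξ + G j t ξ μ) ≤ π ‖μ‖)

/-- A function whose increments are dominated by those of an absolutely continuous function is
absolutely continuous. -/
lemma AbsolutelyContinuousOnInterval.of_dist_le {f G : ℝ → ℝ} {a b : ℝ}
    (hG : AbsolutelyContinuousOnInterval G a b)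
    (h : ∀ s ∈ uIcc a b, ∀ t ∈ uIcc a b, dist (f s) (f t) ≤ dist (G s) (G t)) :
    AbsolutelyContinuousOnInterval f a b := by
  rw [absolutelyContinuousOnInterval_iff] at hG ⊢
  intro ε hε
  obtain ⟨δ, hδ, H⟩ := hG ε hε
  refine ⟨δ, hδ, fun E hE hlen => lt_of_le_of_lt (Finset.sum_le_sum fun i hi => ?_) (H E hE hlen)⟩
  exact h _ (hE.1 i hi).1 _ (hE.1 i hi).2

/-- A locally Lipschitz function is absolutely continuous along an integral curve. -/
lemma absolutelyContinuousOnInterval_comp_integral {E : Type*} [NormedAddCommGroup E]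
    [NormedSpace ℝ E] [CompleteSpace E] {V : ℝ → E → ℝ} {x F : ℝ → E} {a b : ℝ}
    {S : Set (ℝ × E)} (hab : a ≤ b) (hF : IntervalIntegrable F volume a b)
    (hx : ∀ s ∈ Icc a b, x s = x a + ∫ r in a..s, F r)
    (hV : LocLipschitzOn S fun q : ℝ × E => V q.1 q.2)
    (hS : ∀ s ∈ Icc a b, (s, x s) ∈ S) :
    AbsolutelyContinuousOnInterval (fun s => V s (x s)) a b := by
  have hu : uIcc a b = Icc a b := uIcc_of_le hab
  have hFs : ∀ s ∈ Icc a b, ∀ t ∈ Icc a b, IntervalIntegrable F volume s t := fun s hs t ht =>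
    hF.mono_set (uIcc_subset_uIcc (hu ▸ hs) (hu ▸ ht))
  have hcont : ContinuousOn x (Icc a b) := by
    have h1 : ContinuousOn (fun s => x a + ∫ r in a..s, F r) (Icc a b) := by
      have := intervalIntegral.continuousOn_primitive_interval' hF (left_mem_uIcc)
      rw [hu] at this
      exact continuousOn_const.add this
    exact h1.congr hx
  have hK : IsCompact ((fun s => (s, x s)) '' Icc a b) :=
    isCompact_Icc.image_of_continuousOn (continuousOn_id.prodMk hcont)
  have hsub : (fun s => (s, x s)) '' Icc a b ⊆ S := by
    rintro _ ⟨s, hs, rfl⟩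
    exact hS s hs
  obtain ⟨K, hKL⟩ := LocallyLipschitzOn.exists_lipschitzOnWith_of_compact hK
    (LocallyLipschitzOn.mono (fun q hq => hV q hq) hsub)
  have hint : IntervalIntegrable (fun r => K * (1 + ‖F r‖)) volume a b :=
    (intervalIntegrable_const.add hF.norm).const_mul _
  refine (hint.absolutelyContinuousOnInterval_intervalIntegral left_mem_uIcc).of_dist_le ?_
  rw [hu]
  suffices H : ∀ s ∈ Icc a b, ∀ t ∈ Icc a b, s ≤ t → dist (V s (x s)) (V t (x t)) ≤
      dist (∫ r in a..s, K * (1 + ‖F r‖)) (∫ r in a..t, K * (1 + ‖F r‖)) by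
    intro s hs t ht
    rcases le_total s t with h | h
    · exact H s hs t ht h
    · rw [dist_comm, dist_comm (∫ r in a..s, K * (1 + ‖F r‖))]
      exact H t ht s hs h
  intro s hs t ht hst
  have h1 := hKL.dist_le_mul (s, x s) ⟨s, hs, rfl⟩ (t, x t) ⟨t, ht, rfl⟩
  refine h1.trans ?_
  have ha : a ∈ Icc a b := left_mem_Icc.2 hab
  have hints : ∀ s ∈ Icc a b, IntervalIntegrable (fun r => K * (1 + ‖F r‖)) volume a s :=
    fun s hs => hint.mono_set (uIcc_subset_uIcc left_mem_uIcc (hu ▸ hs))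
  rw [dist_comm (∫ r in a..s, K * (1 + ‖F r‖)), Real.dist_eq,
    intervalIntegral.integral_interval_sub_left (hints t ht) (hints s hs),
    intervalIntegral.integral_const_mul, intervalIntegral.integral_add intervalIntegrable_const
      (hFs s hs t ht).norm]
  refine le_trans ?_ (le_abs_self _)
  refine mul_le_mul_of_nonneg_left ?_ K.2
  have hnn : 0 ≤ ∫ r in s..t, ‖F r‖ :=
    intervalIntegral.integral_nonneg hst fun _ _ => norm_nonneg _
  have hxd : dist (x s) (x t) ≤ ∫ r in s..t, ‖F r‖ := by
    rw [dist_comm, dist_eq_norm, hx s hs, hx t ht, add_sub_add_left_eq_sub,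
      intervalIntegral.integral_interval_sub_left (hFs a ha t ht) (hFs a ha s hs)]
    exact intervalIntegral.norm_integral_le_integral_norm hst
  rw [Prod.dist_eq, intervalIntegral.integral_const, smul_eq_mul, mul_one]
  refine max_le ?_ (by linarith)
  rw [Real.dist_eq, abs_sub_comm, abs_of_nonneg (by linarith)]
  linarith

/-- Along a differentiable curve, the Dini derivative of a locally Lipschitz function is its
derivative along the curve, whenever the latter exists. -/
lemma diniAlong_eq_of_hasDerivAt {n m : ℕ} {f : ℝ → Stt n → Stt m → Stt n}
    {V : ℝ → Stt n → ℝ} {x : ℝ → Stt n} {a b s d : ℝ} {μ : Stt m}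
    (hs : s ∈ Ico a b)
    (hV : LocLipschitzOn (Ico a b ×ˢ (univ : Set (Stt n))) fun q : ℝ × Stt n => V q.1 q.2)
    (hx : HasDerivAt x (f s (x s) μ) s) (hv : HasDerivAt (fun r => V r (x r)) d s) :
    DiniAlong f V s (x s) μ = d := by
  obtain ⟨K, t, ht, hK⟩ := hV (s, x s) ⟨hs, mem_univ _⟩
  set F := f s (x s) μ with hF
  have hmem : ∀ᶠ r : ℝ in nhdsWithin 0 (Ioi 0), s + r ∈ Ico a b := by
    have h1 : ∀ᶠ r : ℝ in nhdsWithin 0 (Ioi 0), r < b - s :=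
      mem_nhdsWithin_of_mem_nhds (Iio_mem_nhds (by linarith [hs.2]))
    filter_upwards [h1, self_mem_nhdsWithin] with r h1 h2
    exact ⟨by linarith [hs.1, mem_Ioi.1 h2], by linarith⟩
  have hin : ∀ y : ℝ → Stt n, Tendsto y (nhdsWithin 0 (Ioi 0)) (nhds (x s)) →
      ∀ᶠ r : ℝ in nhdsWithin 0 (Ioi 0), (s + r, y r) ∈ t := by
    intro y hy
    have h1 : Tendsto (fun r : ℝ => (s + r, y r)) (nhdsWithin 0 (Ioi 0))
        (nhdsWithin (s, x s) (Ico a b ×ˢ univ)) := by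
      refine tendsto_nhdsWithin_iff.2 ⟨?_, ?_⟩
      · refine Tendsto.prodMk_nhds ?_ hy
        have : Tendsto (fun r : ℝ => s + r) (nhds 0) (nhds (s + 0)) :=
          (continuous_const.add continuous_id).tendsto 0
        rw [add_zero] at this
        exact this.mono_left nhdsWithin_le_nhds
      · filter_upwards [hmem] with r hr
        exact ⟨hr, mem_univ _⟩
    exact h1 ht
  have hshift : Tendsto (fun r : ℝ => s + r) (nhdsWithin 0 (Ioi 0)) (nhds s) := by
    have : Tendsto (fun r : ℝ => s + r) (nhds 0) (nhds (s + 0)) :=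
      (continuous_const.add continuous_id).tendsto 0
    rw [add_zero] at this
    exact this.mono_left nhdsWithin_le_nhds
  have e1 := hin (fun r => x (s + r)) (hx.continuousAt.tendsto.comp hshift)
  have e2 := hin (fun r => x s + r • F) (by
    have : Tendsto (fun r : ℝ => x s + r • F) (nhds 0) (nhds (x s + (0 : ℝ) • F)) :=
      (continuous_const.add (continuous_id.smul continuous_const)).tendsto 0
    rw [zero_smul, add_zero] at this
    exact this.mono_left nhdsWithin_le_nhds)
  have hsub : nhdsWithin (0 : ℝ) (Ioi 0) ≤ nhdsWithin 0 {0}ᶜ :=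
    nhdsWithin_mono _ fun r hr => ne_of_gt hr
  have q1 : Tendsto (fun r : ℝ => r⁻¹ • (V (s + r) (x (s + r)) - V s (x s)))
      (nhdsWithin 0 (Ioi 0)) (nhds d) :=
    (hasDerivAt_iff_tendsto_slope_zero.1 hv).mono_left hsub
  have q2 : Tendsto (fun r : ℝ => r⁻¹ • (x (s + r) - x s)) (nhdsWithin 0 (Ioi 0)) (nhds F) :=
    (hasDerivAt_iff_tendsto_slope_zero.1 hx).mono_left hsub
  have q3 : Tendsto (fun r : ℝ => (V (s + r) (x s + r • F) - V (s + r) (x (s + r))) / r)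
      (nhdsWithin 0 (Ioi 0)) (nhds 0) := by
    have hz : Tendsto (fun r : ℝ => (K : ℝ) * ‖r⁻¹ • (x (s + r) - x s) - F‖)
        (nhdsWithin 0 (Ioi 0)) (nhds 0) := by
      have := ((q2.sub_const F).norm).const_mul (K : ℝ)
      simpa using this
    refine squeeze_zero_norm' ?_ hz
    filter_upwards [e1, e2, self_mem_nhdsWithin] with r h1 h2 hr
    have hr' : (0 : ℝ) < r := hr
    have := hK.dist_le_mul _ h2 _ h1
    simp only [Prod.dist_eq, dist_self, Real.dist_eq] at this
    rw [max_eq_right dist_nonneg, dist_eq_norm] at this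
    have e : r⁻¹ • (x (s + r) - x s) - F = -(r⁻¹ • (x s + r • F - x (s + r))) := by
      simp only [smul_sub, smul_add, smul_smul, inv_mul_cancel₀ hr'.ne', one_smul]
      abel
    rw [e, norm_neg, norm_smul, Real.norm_eq_abs, Real.norm_eq_abs, abs_div, abs_inv,
      abs_of_pos hr', div_le_iff₀ hr']
    calc _ ≤ _ := this
      _ = _ := by field_simp
  have q4 := q3.add q1
  rw [zero_add] at q4
  refine Tendsto.limsup_eq (q4.congr fun r => ?_)
  rw [smul_eq_mul]
  ring

/-- The primitive of `1 / φ` on the positive half-line, based at `1`. -/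
def invPrimitive (φ : ℝ → ℝ) (r : ℝ) : ℝ := ∫ s in (1 : ℝ)..r, (φ s)⁻¹

section InvPrimitive

variable {φ : ℝ → ℝ}

lemma PosDef.intervalIntegrable_inv (hφ : PosDef φ) {a b : ℝ} (ha : 0 < a) (hb : 0 < b) :
    IntervalIntegrable (fun s => (φ s)⁻¹) volume a b := by
  have hpos : ∀ s ∈ uIcc a b, 0 < s := fun s hs => lt_of_lt_of_le (lt_min ha hb) hs.1
  exact ((hφ.1.mono fun s hs => (hpos s hs).le).inv₀ fun s hs =>
    (hφ.2.2 s (hpos s hs)).ne').intervalIntegrable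

lemma PosDef.invPrimitive_sub (hφ : PosDef φ) {a b : ℝ} (ha : 0 < a) (hb : 0 < b) :
    invPrimitive φ b - invPrimitive φ a = ∫ s in a..b, (φ s)⁻¹ :=
  intervalIntegral.integral_interval_sub_left (hφ.intervalIntegrable_inv one_pos hb)
    (hφ.intervalIntegrable_inv one_pos ha)

lemma PosDef.hasDerivAt_invPrimitive (hφ : PosDef φ) {r : ℝ} (hr : 0 < r) :
    HasDerivAt (invPrimitive φ) (φ r)⁻¹ r := by
  have hc : ContinuousOn (fun s => (φ s)⁻¹) (Ioi 0) :=
    (hφ.1.mono Ioi_subset_Ici_self).inv₀ fun s hs => (hφ.2.2 s hs).ne'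
  exact intervalIntegral.integral_hasDerivAt_right (hφ.intervalIntegrable_inv one_pos hr)
    (hc.stronglyMeasurableAtFilter isOpen_Ioi r hr) (hc.continuousAt (Ioi_mem_nhds hr))

lemma PosDef.continuousAt_invPrimitive (hφ : PosDef φ) {r : ℝ} (hr : 0 < r) :
    ContinuousAt (invPrimitive φ) r :=
  (hφ.hasDerivAt_invPrimitive hr).continuousAt

lemma PosDef.strictMonoOn_invPrimitive (hφ : PosDef φ) :
    StrictMonoOn (invPrimitive φ) (Ioi 0) := by
  refine strictMonoOn_of_deriv_pos (convex_Ioi 0)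
    (fun r hr => (hφ.continuousAt_invPrimitive hr).continuousWithinAt) fun r hr => ?_
  rw [interior_Ioi] at hr
  rw [(hφ.hasDerivAt_invPrimitive hr).deriv]
  exact inv_pos.2 (hφ.2.2 r hr)

/-- Integration of the differential inequality `dv/dt ≤ -p φ(v)` for a positive absolutely
continuous function `v`. -/
lemma PosDef.invPrimitive_le_of_deriv_le (hφ : PosDef φ) {p v : ℝ → ℝ} {a b : ℝ} (hab : a ≤ b)
    (hp : IntervalIntegrable p volume a b) (hv : AbsolutelyContinuousOnInterval v a b)
    (hpos : ∀ s ∈ Icc a b, 0 < v s)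
    (hd : ∀ᵐ s, s ∈ Icc a b → deriv v s ≤ -(p s * φ (v s))) :
    invPrimitive φ (v b) ≤ invPrimitive φ (v a) - ∫ s in a..b, p s := by
  have hu : uIcc a b = Icc a b := uIcc_of_le hab
  have hvc : ContinuousOn v (Icc a b) := hu ▸ hv.continuousOn
  obtain ⟨c, hc, hcmin⟩ := isCompact_Icc.exists_isMinOn (nonempty_Icc.2 hab) hvc
  obtain ⟨e, he, hemax⟩ := isCompact_Icc.exists_isMaxOn (nonempty_Icc.2 hab) hvc
  have hrange : ∀ s ∈ Icc a b, v s ∈ Icc (v c) (v e) := fun s hs => ⟨hcmin hs, hemax hs⟩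
  have hle : v c ≤ v e := hcmin he
  have hposI : ∀ r ∈ Icc (v c) (v e), 0 < r := fun r hr => (hpos c hc).trans_le hr.1
  have hinv : ContinuousOn (fun s => (φ s)⁻¹) (Icc (v c) (v e)) :=
    (hφ.1.mono fun r hr => (hposI r hr).le).inv₀ fun r hr => (hφ.2.2 r (hposI r hr)).ne'
  obtain ⟨C, hC⟩ := isCompact_Icc.exists_bound_of_continuousOn hinv
  have hlip : ∀ r ∈ Icc (v c) (v e), ∀ r' ∈ Icc (v c) (v e),
      ‖invPrimitive φ r' - invPrimitive φ r‖ ≤ C * ‖r' - r‖ := fun r hr r' hr' =>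
    (convex_Icc (v c) (v e)).norm_image_sub_le_of_norm_hasDerivWithin_le
      (fun y hy => (hφ.hasDerivAt_invPrimitive (hposI y hy)).hasDerivWithinAt) hC hr hr'
  have hac : AbsolutelyContinuousOnInterval (fun s => invPrimitive φ (v s)) a b := by
    refine (hv.const_mul C).of_dist_le fun s hs t ht => ?_
    rw [hu] at hs ht
    rw [dist_eq_norm]
    refine (hlip _ (hrange t ht) _ (hrange s hs)).trans ?_
    rw [Real.dist_eq, ← mul_sub, abs_mul, Real.norm_eq_abs]
    exact mul_le_mul_of_nonneg_right (le_abs_self C) (abs_nonneg _)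
  have hint := hac.integral_deriv_eq_sub
  have hmono : ∫ s in a..b, deriv (fun s => invPrimitive φ (v s)) s ≤ ∫ s in a..b, -p s := by
    refine intervalIntegral.integral_mono_ae_restrict hab hac.intervalIntegrable_deriv hp.neg ?_
    rw [EventuallyLE, ae_restrict_iff' measurableSet_Icc]
    filter_upwards [hd, hv.ae_differentiableAt] with s h1 h2 hs
    have h3 := (h2 (hu ▸ hs)).hasDerivAt
    have h4 : HasDerivAt (fun s => invPrimitive φ (v s)) ((φ (v s))⁻¹ * deriv v s) s :=
      (hφ.hasDerivAt_invPrimitive (hpos s hs)).comp s h3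
    have h5 := hφ.2.2 _ (hpos s hs)
    rw [h4.deriv, inv_mul_le_iff₀ h5]
    simpa [mul_comm] using h1 hs
  rw [hint, intervalIntegral.integral_neg] at hmono
  linarith

/-- Version of `PosDef.invPrimitive_le_of_deriv_le` in which positivity at the left endpoint is a
conclusion. -/
lemma PosDef.invPrimitive_le_of_deriv_le' (hφ : PosDef φ) {p v : ℝ → ℝ} {a b : ℝ} (hab : a ≤ b)
    (hp : IntervalIntegrable p volume a b) (hpnn : ∀ s ∈ Icc a b, 0 ≤ p s)
    (hv : AbsolutelyContinuousOnInterval v a b)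
    (hpos : ∀ s ∈ Ioc a b, 0 < v s)
    (hd : ∀ᵐ s, s ∈ Ioc a b → deriv v s ≤ -(p s * φ (v s))) :
    v b ≤ v a ∧ (0 < v a →
      invPrimitive φ (v b) ≤ invPrimitive φ (v a) - ∫ s in a..b, p s) := by
  have hu : uIcc a b = Icc a b := uIcc_of_le hab
  have hvc : ContinuousOn v (Icc a b) := hu ▸ hv.continuousOn
  have key : ∀ c ∈ Ioc a b, v b ≤ v c := by
    intro c hc
    have hsub : Icc c b ⊆ Ioc a b := fun s hs => ⟨hc.1.trans_le hs.1, hs.2⟩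
    have hsub' : uIcc c b ⊆ uIcc a b := by
      rw [hu, uIcc_of_le hc.2]
      exact hsub.trans Ioc_subset_Icc_self
    have h1 := hφ.invPrimitive_le_of_deriv_le hc.2 (hp.mono_set hsub') (hv.mono hsub')
      (fun s hs => hpos s (hsub hs)) (hd.mono fun s h hs => h (hsub hs))
    have h2 : 0 ≤ ∫ s in c..b, p s := intervalIntegral.integral_nonneg hc.2 fun s hs =>
      hpnn s (Ioc_subset_Icc_self (hsub hs))
    exact (hφ.strictMonoOn_invPrimitive.le_iff_le (hpos b (hsub (right_mem_Icc.2 hc.2)))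
      (hpos c hc)).1 (by linarith)
  have hba : v b ≤ v a := by
    rcases hab.eq_or_lt with rfl | hlt
    · exact le_rfl
    have h1 : Tendsto v (nhdsWithin a (Ioc a b)) (nhds (v a)) :=
      (hvc a (left_mem_Icc.2 hab)).mono_left (nhdsWithin_mono _ Ioc_subset_Icc_self)
    have : (nhdsWithin a (Ioc a b)).NeBot := by
      rw [nhdsWithin_Ioc_eq_nhdsGT hlt]
      infer_instance
    exact ge_of_tendsto h1 (eventually_nhdsWithin_of_forall key)
  refine ⟨hba, fun ha => ?_⟩
  refine hφ.invPrimitive_le_of_deriv_le hab hp hv (fun s hs => ?_) ?_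
  · rcases hs.1.eq_or_lt with rfl | h
    · exact ha
    · exact hpos s ⟨h, hs.2⟩
  · have hne : ∀ᵐ s : ℝ, s ≠ a := by simp [ae_iff, measure_singleton]
    filter_upwards [hd, hne] with s h1 h2 hs
    exact h1 ⟨lt_of_le_of_ne hs.1 (Ne.symm h2), hs.2⟩

end InvPrimitive

section Dwell

variable {p : ℝ → ℝ} {θ M : ℝ}

/-- A function whose integral over each window of length `θ` is at least `M` has integral at least
`k * M` over `k` consecutive windows. -/
lemma natCast_mul_le_integral (hp : ∀ a b : ℝ, IntervalIntegrable p volume a b)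
    (hθ : 0 ≤ θ) (hM : ∀ t, 0 ≤ t → M ≤ ∫ s in t..(t + θ), p s) {a : ℝ} (ha : 0 ≤ a) (k : ℕ) :
    k * M ≤ ∫ s in a..(a + k * θ), p s := by
  induction k with
  | zero => simp
  | succ k ih =>
    have h1 := hM (a + k * θ) (by positivity)
    rw [← intervalIntegral.integral_add_adjacent_intervals (hp a (a + k * θ)) (hp _ _)]
    have e : a + ((k + 1 : ℕ) : ℝ) * θ = a + k * θ + θ := by push_cast; ring
    rw [e]
    push_cast
    linarith

lemma mul_sub_one_le_integral (hp : ∀ a b : ℝ, IntervalIntegrable p volume a b)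
    (hpnn : ∀ t, 0 ≤ t → 0 ≤ p t) (hθ : 0 < θ) (hM0 : 0 ≤ M)
    (hM : ∀ t, 0 ≤ t → M ≤ ∫ s in t..(t + θ), p s) {a b : ℝ} (ha : 0 ≤ a) (hab : a ≤ b) :
    M * ((b - a) / θ - 1) ≤ ∫ s in a..b, p s := by
  have h0 : 0 ≤ (b - a) / θ := div_nonneg (by linarith) hθ.le
  set k := ⌊(b - a) / θ⌋₊ with hk
  have h1 : (k : ℝ) * θ ≤ b - a := by
    have := Nat.floor_le h0
    rwa [le_div_iff₀ hθ] at this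
  have h2 := natCast_mul_le_integral hp hθ.le hM ha k
  have h3 : (b - a) / θ < k + 1 := Nat.lt_floor_add_one _
  have h4 : 0 ≤ ∫ s in (a + k * θ)..b, p s :=
    intervalIntegral.integral_nonneg (by linarith) fun s hs =>
      hpnn s (le_trans (by positivity) hs.1)
  rw [← intervalIntegral.integral_add_adjacent_intervals (hp a (a + k * θ)) (hp _ _)]
  nlinarith

lemma le_integral_of_le_length (hp : ∀ a b : ℝ, IntervalIntegrable p volume a b)
    (hpnn : ∀ t, 0 ≤ t → 0 ≤ p t) (hθ : 0 < θ)
    (hM : ∀ t, 0 ≤ t → M ≤ ∫ s in t..(t + θ), p s) {a b : ℝ} (ha : 0 ≤ a) (hab : a + θ ≤ b) :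
    M ≤ ∫ s in a..b, p s := by
  have h4 : 0 ≤ ∫ s in (a + θ)..b, p s :=
    intervalIntegral.integral_nonneg hab fun s hs => hpnn s (by linarith [hs.1])
  rw [← intervalIntegral.integral_add_adjacent_intervals (hp a (a + θ)) (hp _ _)]
  linarith [hM a ha]

variable {S : ℝ}

lemma rate_mul_sub_le_integral (hp : ∀ a b : ℝ, IntervalIntegrable p volume a b)
    (hpnn : ∀ t, 0 ≤ t → 0 ≤ p t) (hθ : 0 < θ) (hS : 0 ≤ S) (hSM : S ≤ M)
    (hM : ∀ t, 0 ≤ t → M ≤ ∫ s in t..(t + θ), p s) {a b : ℝ} (ha : 0 ≤ a) (hab : a ≤ b) :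
    (M - S) / (2 * θ) * (b - a) - M ≤ ∫ s in a..b, p s := by
  have h := mul_sub_one_le_integral hp hpnn hθ (hS.trans hSM) hM ha hab
  have h0 : 0 ≤ (b - a) / θ := div_nonneg (by linarith) hθ.le
  have e : (M - S) / (2 * θ) * (b - a) = (M - S) / 2 * ((b - a) / θ) := by field_simp
  rw [e]
  nlinarith

lemma add_rate_mul_le_integral (hp : ∀ a b : ℝ, IntervalIntegrable p volume a b)
    (hpnn : ∀ t, 0 ≤ t → 0 ≤ p t) (hθ : 0 < θ) (hS : 0 ≤ S) (hSM : S ≤ M)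
    (hM : ∀ t, 0 ≤ t → M ≤ ∫ s in t..(t + θ), p s) {a b : ℝ} (ha : 0 ≤ a) (hab : a + θ ≤ b) :
    S + (M - S) / (2 * θ) * (b - a) ≤ ∫ s in a..b, p s := by
  have h := mul_sub_one_le_integral hp hpnn hθ (hS.trans hSM) hM ha (by linarith : a ≤ b)
  have h' := le_integral_of_le_length hp hpnn hθ hM ha hab
  have e : (M - S) / (2 * θ) * (b - a) = (M - S) / 2 * ((b - a) / θ) := by field_simp
  rw [e]
  rcases le_total ((b - a) / θ) 2 with h2 | h2 <;> nlinarith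

end Dwell

section Impulsive

variable {γ : Set ℝ} {w : ℝ → ℝ} {q : ℝ → ℝ → ℝ} {σ t θ S M c : ℝ}

lemma IsImpulseSeq.finite_of_subset_Iic (hγ : IsImpulseSeq γ) {A : Set ℝ} {T : ℝ}
    (hA : A ⊆ Iic T) : (γ ∩ A).Finite :=
  (hγ.2 T).subset (inter_subset_inter_right _ hA)

/-- Decay between impulse times under a dwell-time condition. -/
lemma impulse_decay_le (hγ : IsImpulseSeq γ)
    (hsep : ∀ s ∈ γ, ∀ t ∈ γ, s < t → θ ≤ t - s)
    (hq : ∀ a b, σ ≤ a → a + θ ≤ b → S + c * (b - a) ≤ q a b)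
    (hjump : ∀ a τ, σ ≤ a → a < τ → τ ≤ t → τ ∈ γ → Ioo a τ ∩ γ = ∅ →
      w τ ≤ w a - q a τ + S)
    {τ s : ℝ} (hτ : τ ∈ γ) (hστ : σ ≤ τ) (hs : s ∈ γ) (hτs : τ ≤ s) (hst : s ≤ t) :
    w s ≤ w τ - c * (s - τ) := by
  by_contra hbad
  set B := {r | r ∈ γ ∩ Icc τ t ∧ ¬ w r ≤ w τ - c * (r - τ)} with hB
  have hBfin : B.Finite :=
    (hγ.finite_of_subset_Iic (Icc_subset_Iic_self : Icc τ t ⊆ Iic t)).subset fun r hr => hr.1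
  obtain ⟨r, hr⟩ := hBfin.exists_minimal ⟨s, ⟨hs, hτs, hst⟩, hbad⟩
  obtain ⟨⟨⟨hrγ, hτr, hrt⟩, hrbad⟩, hrmin⟩ := hr
  have hlt : τ < r := by
    rcases hτr.eq_or_lt with rfl | h
    · exact absurd (by simp) hrbad
    · exact h
  have hPfin : (γ ∩ Ico τ r).Finite :=
    hγ.finite_of_subset_Iic (T := r) fun y hy => hy.2.le
  obtain ⟨τ', ⟨hτ'γ, hττ', hτ'r⟩, hmax⟩ := hPfin.exists_maximal ⟨τ, hτ, le_rfl, hlt⟩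
  have hgood : w τ' ≤ w τ - c * (τ' - τ) := by
    by_contra h
    have := hrmin (y := τ') ⟨⟨hτ'γ, hττ', by linarith⟩, h⟩ hτ'r.le
    linarith
  have hempty : Ioo τ' r ∩ γ = ∅ := by
    ext y
    simp only [mem_inter_iff, mem_Ioo, mem_empty_iff_false, iff_false]
    rintro ⟨⟨h1, h2⟩, h3⟩
    have := hmax (y := y) ⟨h3, by linarith, h2⟩ h1.le
    linarith
  have h1 := hjump τ' r (by linarith) hτ'r hrt hrγ hempty
  have h2 := hq τ' r (by linarith) (by linarith [hsep τ' hτ'γ r hrγ hτ'r])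
  exact hrbad (by linarith)

lemma impulse_decay_le_of_mem (hγ : IsImpulseSeq γ)
    (hsep : ∀ s ∈ γ, ∀ t ∈ γ, s < t → θ ≤ t - s) (hc : 0 ≤ c)
    (hq0 : ∀ a b, σ ≤ a → a ≤ b → 0 ≤ q a b)
    (hq1 : ∀ a b, σ ≤ a → a ≤ b → c * (b - a) - M ≤ q a b)
    (hq : ∀ a b, σ ≤ a → a + θ ≤ b → S + c * (b - a) ≤ q a b)
    (hflow : ∀ a b, σ ≤ a → a ≤ b → b ≤ t → Ioc a b ∩ γ = ∅ → w b ≤ w a - q a b)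
    (hjump : ∀ a τ, σ ≤ a → a < τ → τ ≤ t → τ ∈ γ → Ioo a τ ∩ γ = ∅ →
      w τ ≤ w a - q a τ + S)
    {τ s : ℝ} (hτ : τ ∈ γ) (hστ : σ ≤ τ) (hτs : τ ≤ s) (hst : s ≤ t) :
    w s ≤ w τ - c * (s - τ) + M ∧ w s ≤ w τ := by
  have hPfin : (γ ∩ Icc τ s).Finite :=
    hγ.finite_of_subset_Iic (T := s) fun y hy => hy.2
  obtain ⟨τ', ⟨hτ'γ, hττ', hτ's⟩, hmax⟩ := hPfin.exists_maximal ⟨τ, hτ, le_rfl, hτs⟩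
  have hempty : Ioc τ' s ∩ γ = ∅ := by
    ext y
    simp only [mem_inter_iff, mem_Ioc, mem_empty_iff_false, iff_false]
    rintro ⟨⟨h1, h2⟩, h3⟩
    have := hmax (y := y) ⟨h3, by linarith, h2⟩ h1.le
    linarith
  have h0 := impulse_decay_le hγ hsep hq hjump hτ hστ hτ'γ hττ' (by linarith)
  have h1 := hflow τ' s (by linarith) hτ's hst hempty
  have h2 := hq0 τ' s (by linarith) hτ's
  have h3 := hq1 τ' s (by linarith) hτ's
  have h4 : 0 ≤ c * (τ' - τ) := mul_nonneg hc (by linarith)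
  constructor <;> linarith

lemma impulse_decay (hγ : IsImpulseSeq γ)
    (hsep : ∀ s ∈ γ, ∀ t ∈ γ, s < t → θ ≤ t - s) (hc : 0 ≤ c) (hM : 0 ≤ M) (hSM : S ≤ M)
    (hq0 : ∀ a b, σ ≤ a → a ≤ b → 0 ≤ q a b)
    (hq1 : ∀ a b, σ ≤ a → a ≤ b → c * (b - a) - M ≤ q a b)
    (hq : ∀ a b, σ ≤ a → a + θ ≤ b → S + c * (b - a) ≤ q a b)
    (hflow : ∀ a b, σ ≤ a → a ≤ b → b ≤ t → Ioc a b ∩ γ = ∅ → w b ≤ w a - q a b)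
    (hjump : ∀ a τ, σ ≤ a → a < τ → τ ≤ t → τ ∈ γ → Ioo a τ ∩ γ = ∅ →
      w τ ≤ w a - q a τ + S) (hσt : σ ≤ t) :
    w t ≤ w σ - c * (t - σ) + 3 * M ∧
      (Ioc σ t ∩ γ = ∅ ∨ ∃ τ ∈ γ, σ < τ ∧ τ ≤ t ∧ Ioo σ τ ∩ γ = ∅ ∧ w t ≤ w τ) := by
  rcases eq_empty_or_nonempty (Ioc σ t ∩ γ) with he | hne
  · have h1 := hflow σ t le_rfl hσt le_rfl he
    have h3 := hq1 σ t le_rfl hσt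
    exact ⟨by linarith, Or.inl he⟩
  · have hPfin : (Ioc σ t ∩ γ).Finite := by
      rw [inter_comm]
      exact hγ.finite_of_subset_Iic (T := t) fun y hy => hy.2
    obtain ⟨τ, ⟨⟨hστ, hτt⟩, hτ⟩, hmin⟩ := hPfin.exists_minimal hne
    have hempty : Ioo σ τ ∩ γ = ∅ := by
      ext y
      simp only [mem_inter_iff, mem_Ioo, mem_empty_iff_false, iff_false]
      rintro ⟨⟨h1, h2⟩, h3⟩
      have := hmin (y := y) ⟨⟨h1, by linarith⟩, h3⟩ h2.le
      linarith
    obtain ⟨h1, h2⟩ := impulse_decay_le_of_mem hγ hsep hc hq0 hq1 hq hflow hjump hτ hστ.le hτt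
      le_rfl
    have h3 := hjump σ τ le_rfl hστ hτt hτ hempty
    have h4 := hq1 σ τ le_rfl hστ.le
    exact ⟨by linarith, Or.inr ⟨τ, hτ, hστ, hτt, hempty, h2⟩⟩

/-- A sequence with dwell time `θ` has at most `(t - s) / θ + 1` elements in `(s, t]`. -/
lemma nJumps_le (hsep : ∀ s ∈ γ, ∀ t ∈ γ, s < t → θ ≤ t - s) (hθ : 0 < θ) {s t : ℝ}
    (hst : s ≤ t) : (nJumps γ s t : ℝ) ≤ (t - s) / θ + 1 := by
  have h0 : 0 ≤ (t - s) / θ := div_nonneg (by linarith) hθ.le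
  have hcard : nJumps γ s t ≤ ⌊(t - s) / θ⌋₊ + 1 := by
    have hmaps : ∀ r ∈ γ ∩ Ioc s t, ⌊(r - s) / θ⌋₊ ∈
        (Finset.range (⌊(t - s) / θ⌋₊ + 1) : Set ℕ) := by
      rintro r ⟨-, -, hr⟩
      simp only [Finset.coe_range, mem_Iio, Nat.lt_succ_iff]
      exact Nat.floor_le_floor (by gcongr)
    have hlt : ∀ r ∈ γ ∩ Ioc s t, ∀ r' ∈ γ ∩ Ioc s t, r < r' →
        ⌊(r - s) / θ⌋₊ < ⌊(r' - s) / θ⌋₊ := by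
      rintro r ⟨hr, hr1, -⟩ r' ⟨hr', hr1', -⟩ h
      have h1 := hsep r hr r' hr' h
      have h2 : 0 ≤ (r - s) / θ := div_nonneg (by linarith) hθ.le
      rw [← Nat.succ_le_iff, Nat.succ_eq_add_one, ← Nat.floor_add_one h2]
      refine Nat.floor_le_floor ?_
      rw [div_add_one hθ.ne']
      gcongr
      linarith
    have hinj : InjOn (fun r => ⌊(r - s) / θ⌋₊) (γ ∩ Ioc s t) := by
      intro r hr r' hr' h
      rcases lt_trichotomy r r' with h' | h' | h'
      · exact absurd h (hlt r hr r' hr' h').ne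
      · exact h'
      · exact absurd h (hlt r' hr' r hr h').ne'
    have := ncard_le_ncard_of_injOn _ hmaps hinj (Finset.finite_toSet _)
    rwa [ncard_coe_finset, Finset.card_range] at this
  have h1 : (nJumps γ s t : ℝ) ≤ (⌊(t - s) / θ⌋₊ + 1 : ℕ) := by exact_mod_cast hcard
  push_cast at h1
  linarith [Nat.floor_le h0]

end Impulsive

section Comparison

/-- Properties of the average of a monotone function over `[r, 2 * r]`. -/
lemma Monotone.average_properties {g : ℝ → ℝ} (hg : Monotone g) (hg0 : g 0 = 0)
    (hsmall : ∀ ε : ℝ, 0 < ε → ∃ δ : ℝ, 0 < δ ∧ g δ ≤ ε) :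
    ContinuousOn (fun r => ∫ z in (1 : ℝ)..2, g (r * z)) (Ici 0) ∧
    MonotoneOn (fun r => ∫ z in (1 : ℝ)..2, g (r * z)) (Ici 0) ∧
    ∀ r : ℝ, 0 ≤ r → g r ≤ ∫ z in (1 : ℝ)..2, g (r * z) ∧
      ∫ z in (1 : ℝ)..2, g (r * z) ≤ g (2 * r) := by
  have hint : ∀ r : ℝ, 0 ≤ r → IntervalIntegrable (fun z => g (r * z)) volume 1 2 := fun r hr =>
    Monotone.intervalIntegrable fun a b hab => hg (mul_le_mul_of_nonneg_left hab hr)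
  have hbounds : ∀ r : ℝ, 0 ≤ r → g r ≤ ∫ z in (1 : ℝ)..2, g (r * z) ∧
      ∫ z in (1 : ℝ)..2, g (r * z) ≤ g (2 * r) := by
    intro r hr
    have h12 : (1 : ℝ) ≤ 2 := by norm_num
    constructor
    · have := intervalIntegral.integral_mono_on h12
        (intervalIntegrable_const (c := g r) (μ := volume)) (hint r hr)
        fun z hz => hg (by nlinarith [hz.1])
      rw [intervalIntegral.integral_const] at this
      norm_num at this
      exact this
    · have := intervalIntegral.integral_mono_on h12 (hint r hr)
        (intervalIntegrable_const (c := g (2 * r)) (μ := volume))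
        fun z hz => hg (by nlinarith [hz.2])
      rw [intervalIntegral.integral_const] at this
      norm_num at this
      exact this
  refine ⟨?_, ?_, hbounds⟩
  · intro r hr
    rcases (mem_Ici.1 hr).eq_or_lt with rfl | hr
    · rw [Metric.continuousWithinAt_iff]
      intro ε hε
      obtain ⟨δ, hδ, hgδ⟩ := hsmall (ε / 2) (by linarith)
      refine ⟨δ / 2, by linarith, fun {y} hy hyd => ?_⟩
      have hy0 : (0 : ℝ) ≤ y := hy
      obtain ⟨b1, b2⟩ := hbounds y hy0
      have e0 : ∫ z in (1 : ℝ)..2, g (0 * z) = 0 := by simp [hg0]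
      rw [Real.dist_eq, sub_zero, abs_of_nonneg hy0] at hyd
      rw [Real.dist_eq, e0, sub_zero, abs_of_nonneg ((hg0 ▸ hg hy0 : (0 : ℝ) ≤ g y).trans b1)]
      have := hg (by linarith : 2 * y ≤ δ)
      linarith
    · refine ContinuousAt.continuousWithinAt ?_
      have hi : ∀ a b : ℝ, IntervalIntegrable g volume a b := fun a b =>
        hg.intervalIntegrable
      have hprim := intervalIntegral.continuous_primitive hi 0
      have hc : ContinuousAt (fun r : ℝ => r⁻¹ * ((∫ z in (0 : ℝ)..(r * 2), g z) -
          ∫ z in (0 : ℝ)..(r * 1), g z)) r := by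
        refine (continuousAt_inv₀ hr.ne').mul (Continuous.continuousAt ?_)
        exact (hprim.comp (continuous_id.mul continuous_const)).sub
          (hprim.comp (continuous_id.mul continuous_const))
      refine hc.congr ?_
      filter_upwards [Ioi_mem_nhds hr] with y hy
      rw [intervalIntegral.integral_comp_mul_left g (ne_of_gt hy), smul_eq_mul,
        intervalIntegral.integral_interval_sub_left (hi _ _) (hi _ _)]
  · intro r hr r' hr' h
    refine intervalIntegral.integral_mono_on (by norm_num) (hint r hr) (hint r' hr') fun z hz => ?_
    exact hg (mul_le_mul_of_nonneg_right h (by linarith [hz.1]))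

/-- A family of sets of reals which is monotone in `r`, antitone in `s`, bounded, small near
`r = 0` and shrinking as `s → ∞` is dominated by a class `KL` function. -/
lemma exists_classKL_of_sets (Y : ℝ → ℝ → Set ℝ)
    (hmono : ∀ r r' s s' : ℝ, 0 ≤ r → r ≤ r' → 0 ≤ s' → s' ≤ s → Y r s ⊆ Y r' s')
    (hbdd : ∀ r : ℝ, 0 ≤ r → BddAbove (Y r 0))
    (hsmall : ∀ ε : ℝ, 0 < ε → ∃ δ : ℝ, 0 < δ ∧ ∀ y ∈ Y δ 0, y ≤ ε)
    (hlim : ∀ r ε : ℝ, 0 ≤ r → 0 < ε → ∃ s : ℝ, 0 ≤ s ∧ ∀ y ∈ Y r s, y ≤ ε) :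
    ∃ β : ℝ → ℝ → ℝ, ClassKL β ∧ ∀ r s : ℝ, 0 ≤ r → 0 ≤ s → ∀ y ∈ Y r s, y ≤ β r s := by
  set ω : ℝ → ℝ → ℝ := fun r s => sSup (insert 0 (Y (max r 0) s)) with hω
  have hb : ∀ r s : ℝ, 0 ≤ s → BddAbove (insert 0 (Y (max r 0) s)) := fun r s hs =>
    ((hbdd _ (le_max_right r 0)).mono
      (hmono _ _ _ _ (le_max_right r 0) le_rfl le_rfl hs)).insert 0
  have hω0 : ∀ r s : ℝ, 0 ≤ s → 0 ≤ ω r s := fun r s hs =>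
    le_csSup (hb r s hs) (mem_insert _ _)
  have hωle : ∀ r s ε : ℝ, 0 ≤ ε → (∀ y ∈ Y (max r 0) s, y ≤ ε) → ω r s ≤ ε := by
    intro r s ε hε h
    refine csSup_le (insert_nonempty _ _) ?_
    rintro y (rfl | hy)
    · exact hε
    · exact h y hy
  have hωmono : ∀ r r' s s' : ℝ, r ≤ r' → 0 ≤ s' → s' ≤ s → ω r s ≤ ω r' s' := by
    intro r r' s s' hr hs' hs
    exact csSup_le_csSup (hb r' s' hs') (insert_nonempty _ _)
      (insert_subset_insert (hmono _ _ _ _ (le_max_right _ _) (max_le_max_right 0 hr) hs' hs))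
  have hωsmall : ∀ s : ℝ, 0 ≤ s → ∀ ε : ℝ, 0 < ε → ∃ δ : ℝ, 0 < δ ∧ ω δ s ≤ ε := by
    intro s hs ε hε
    obtain ⟨δ, hδ, H⟩ := hsmall ε hε
    refine ⟨δ, hδ, hωle _ _ _ hε.le fun y hy => H y ?_⟩
    rw [max_eq_left hδ.le] at hy
    exact hmono δ δ s 0 hδ.le le_rfl le_rfl hs hy
  have hωzero : ∀ s : ℝ, 0 ≤ s → ω 0 s = 0 := by
    intro s hs
    refine le_antisymm (le_of_forall_pos_le_add fun ε hε => ?_) (hω0 0 s hs)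
    obtain ⟨δ, hδ, H⟩ := hωsmall s hs ε hε
    linarith [hωmono 0 δ s s hδ.le hs le_rfl]
  have avg := fun (s : ℝ) (hs : 0 ≤ s) =>
    Monotone.average_properties (g := fun r => ω r s) (fun r r' h => hωmono r r' s s h hs le_rfl)
      (hωzero s hs) (hωsmall s hs)
  refine ⟨fun r s => (∫ z in (1 : ℝ)..2, ω (r * z) s) + r / (1 + s), ⟨?_, ?_⟩, ?_⟩
  · intro s hs
    obtain ⟨hc, hm, hbd⟩ := avg s hs
    have hs1 : 0 < 1 + s := by linarith
    refine ⟨hc.add (continuousOn_id.div_const _), ?_, ?_, ?_⟩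
    · intro r hr r' hr' h
      exact add_lt_add_of_le_of_lt (hm hr hr' h.le) (by gcongr)
    · simp [hωzero s hs]
    · intro K
      refine ⟨|K| * (1 + s), by positivity, ?_⟩
      have h1 := (hω0 (|K| * (1 + s)) s hs).trans (hbd (|K| * (1 + s)) (by positivity)).1
      have h2 : |K| * (1 + s) / (1 + s) = |K| := by field_simp
      simp only [h2]
      linarith [le_abs_self K]
  · intro r hr
    have hanti : AntitoneOn (fun s => ω (2 * r) s) (Ici 0) := fun s hs s' hs' h =>
      hωmono _ _ _ _ le_rfl hs h
    constructor
    · intro s hs s' hs' h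
      have hs0 : (0 : ℝ) ≤ s := hs
      have hs0' : (0 : ℝ) ≤ s' := hs'
      have hint : ∀ s : ℝ, 0 ≤ s → IntervalIntegrable (fun z => ω (r * z) s) volume 1 2 :=
        fun s hs => Monotone.intervalIntegrable fun a b hab =>
          hωmono _ _ s s (mul_le_mul_of_nonneg_left hab hr) hs le_rfl
      refine add_le_add (intervalIntegral.integral_mono_on (by norm_num) (hint s' hs')
        (hint s hs) fun z _ => hωmono _ _ _ _ le_rfl hs h) ?_
      gcongr
    · have t1 : Tendsto (fun s => ω (2 * r) s) atTop (nhds 0) := by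
        rw [Metric.tendsto_atTop]
        intro ε hε
        obtain ⟨s₀, hs₀, H⟩ := hlim (max (2 * r) 0) (ε / 2) (le_max_right _ _) (by linarith)
        refine ⟨s₀, fun s hs => ?_⟩
        have h1 := hanti hs₀ (hs₀.trans hs) hs
        have h2 := hωle (2 * r) s₀ (ε / 2) (by linarith) H
        rw [Real.dist_eq, sub_zero, abs_of_nonneg (hω0 _ _ (hs₀.trans hs))]
        simp only at h1
        linarith
      have t2 : Tendsto (fun s : ℝ => r / (1 + s)) atTop (nhds 0) :=
        tendsto_const_nhds.div_atTop (tendsto_atTop_add_const_left _ _ tendsto_id)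
      have t3 := t1.add t2
      rw [add_zero] at t3
      refine tendsto_of_tendsto_of_tendsto_of_le_of_le' tendsto_const_nhds t3 ?_ ?_
      · filter_upwards [eventually_ge_atTop 0] with s hs
        have := (hω0 r s hs).trans ((avg s hs).2.2 r hr).1
        have : 0 ≤ r / (1 + s) := by positivity
        linarith
      · filter_upwards [eventually_ge_atTop 0] with s hs
        have := ((avg s hs).2.2 r hr).2
        linarith
  · intro r s hr hs y hy
    have h1 : y ≤ ω r s := le_csSup (hb r s hs) (mem_insert_of_mem _ (by rwa [max_eq_left hr]))
    have h2 := ((avg s hs).2.2 r hr).1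
    have h3 : 0 ≤ r / (1 + s) := by positivity
    simp only at h2 ⊢
    linarith

/-- One-parameter version of `exists_classKL_of_sets`. -/
lemma exists_classKInf_of_sets (Z : ℝ → Set ℝ)
    (hmono : ∀ r r' : ℝ, 0 ≤ r → r ≤ r' → Z r ⊆ Z r')
    (hbdd : ∀ r : ℝ, 0 ≤ r → BddAbove (Z r))
    (hsmall : ∀ ε : ℝ, 0 < ε → ∃ δ : ℝ, 0 < δ ∧ ∀ y ∈ Z δ, y ≤ ε) :
    ∃ ρ : ℝ → ℝ, ClassKInf ρ ∧ ∀ r : ℝ, 0 ≤ r → ∀ y ∈ Z r, y ≤ ρ r := by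
  obtain ⟨β, hβ, H⟩ := exists_classKL_of_sets (fun r s => {y | y ∈ Z r ∧ s ≤ 0})
    (fun r r' s s' hr hrr' _ hs y hy => ⟨hmono r r' hr hrr' hy.1, hs.trans hy.2⟩)
    (fun r hr => (hbdd r hr).mono fun y hy => hy.1)
    (fun ε hε => by
      obtain ⟨δ, hδ, h⟩ := hsmall ε hε
      exact ⟨δ, hδ, fun y hy => h y hy.1⟩)
    (fun r ε _ _ => ⟨1, zero_le_one, fun y hy => absurd hy.2 (by norm_num)⟩)
  exact ⟨fun r => β r 0, hβ.1 0 le_rfl, fun r hr y hy => H r 0 hr le_rfl y ⟨hy, le_rfl⟩⟩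

lemma ClassKInf.nonneg {α : ℝ → ℝ} (hα : ClassKInf α) {r : ℝ} (hr : 0 ≤ r) : 0 ≤ α r := by
  have := hα.2.1.monotoneOn (mem_Ici.2 le_rfl) (mem_Ici.2 hr) hr
  rwa [hα.2.2.1] at this

lemma ClassKInf.pos {α : ℝ → ℝ} (hα : ClassKInf α) {r : ℝ} (hr : 0 < r) : 0 < α r := by
  have := hα.2.1 (mem_Ici.2 le_rfl) (mem_Ici.2 hr.le) hr
  rwa [hα.2.2.1] at this

lemma ClassKInf.mono {α : ℝ → ℝ} (hα : ClassKInf α) {r s : ℝ} (hr : 0 ≤ r) (hrs : r ≤ s) :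
    α r ≤ α s :=
  hα.2.1.monotoneOn (mem_Ici.2 hr) (mem_Ici.2 (hr.trans hrs)) hrs

lemma ClassKInf.comp {α β : ℝ → ℝ} (hα : ClassKInf α) (hβ : ClassKInf β) :
    ClassKInf fun r => α (β r) := by
  have hmaps : MapsTo β (Ici 0) (Ici 0) := fun r hr => hβ.nonneg hr
  refine ⟨hα.1.comp hβ.1 hmaps, hα.2.1.comp hβ.2.1 hmaps, ?_, fun M => ?_⟩
  · simp only [hβ.2.2.1, hα.2.2.1]
  · obtain ⟨q, hq, hMq⟩ := hα.2.2.2 M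
    obtain ⟨r, hr, hqr⟩ := hβ.2.2.2 q
    exact ⟨r, hr, hMq.trans (hα.mono hq hqr)⟩

lemma ClassKInf.add {α β : ℝ → ℝ} (hα : ClassKInf α) (hβ : ClassKInf β) :
    ClassKInf fun r => α r + β r := by
  refine ⟨hα.1.add hβ.1, hα.2.1.add hβ.2.1, ?_, fun M => ?_⟩
  · simp only [hβ.2.2.1, hα.2.2.1, add_zero]
  · obtain ⟨r, hr, hMr⟩ := hα.2.2.2 M
    exact ⟨r, hr, by linarith [hβ.nonneg hr]⟩

/-- A function continuous on `[0, ∞)` and vanishing at `0` is small near `0`. -/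
lemma exists_pos_forall_le_of_continuousOn {α : ℝ → ℝ} (hc : ContinuousOn α (Ici 0))
    (h0 : α 0 = 0) {ε : ℝ} (hε : 0 < ε) : ∃ δ : ℝ, 0 < δ ∧ ∀ r, 0 ≤ r → r ≤ δ → α r ≤ ε := by
  obtain ⟨δ, hδ, H⟩ := Metric.continuousWithinAt_iff.1 (hc 0 (mem_Ici.2 le_rfl)) ε hε
  refine ⟨δ / 2, by linarith, fun r hr hrδ => ?_⟩
  have := H (mem_Ici.2 hr) (by rw [Real.dist_eq, sub_zero, abs_of_nonneg hr]; linarith)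
  rw [h0, Real.dist_eq, sub_zero] at this
  exact (le_abs_self _).trans this.le

/-- Every function continuous on `[0, ∞)` and vanishing at `0` has a class `K∞` majorant which
dominates it uniformly on `[0, r]`. -/
lemma exists_classKInf_dominating {α : ℝ → ℝ} (hc : ContinuousOn α (Ici 0)) (h0 : α 0 = 0) :
    ∃ B : ℝ → ℝ, ClassKInf B ∧ ∀ r, 0 ≤ r → r ≤ B r ∧ ∀ a, 0 ≤ a → a ≤ r → α a ≤ B r := by
  obtain ⟨B, hB, H⟩ := exists_classKInf_of_sets
    (fun r => {y | ∃ a, 0 ≤ a ∧ a ≤ r ∧ y ≤ max a (α a)})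
    (fun r r' _ hrr' y ⟨a, ha, har, hy⟩ => ⟨a, ha, har.trans hrr', hy⟩)
    (fun r hr => by
      obtain ⟨C, hC⟩ := isCompact_Icc.exists_bound_of_continuousOn
        (hc.mono (Icc_subset_Ici_self : Icc 0 r ⊆ Ici 0))
      refine ⟨max r C, ?_⟩
      rintro y ⟨a, ha, har, hy⟩
      exact hy.trans (max_le_max har ((le_abs_self _).trans (hC a ⟨ha, har⟩))))
    (fun ε hε => by
      obtain ⟨δ, hδ, h⟩ := exists_pos_forall_le_of_continuousOn hc h0 hε
      refine ⟨min δ ε, lt_min hδ hε, ?_⟩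
      rintro y ⟨a, ha, har, hy⟩
      exact hy.trans (max_le (har.trans (min_le_right _ _)) (h a ha (har.trans (min_le_left _ _)))))
  exact ⟨B, hB, fun r hr => ⟨H r hr r ⟨r, hr, le_rfl, le_max_left _ _⟩,
    fun a ha har => H r hr _ ⟨a, ha, har, le_max_right _ _⟩⟩⟩

/-- The inverse of a class `K∞` function composed with a class `K∞` function is dominated by a
class `K∞` function. -/
lemma exists_classKInf_of_le_comp {φ κ : ℝ → ℝ} (hφ : ClassKInf φ) (hκ : ClassKInf κ) :
    ∃ ρ : ℝ → ℝ, ClassKInf ρ ∧ ∀ r y : ℝ, 0 ≤ r → 0 ≤ y → φ y ≤ κ r → y ≤ ρ r := by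
  have hle : ∀ y z : ℝ, 0 ≤ y → 0 ≤ z → φ y ≤ φ z → y ≤ z := fun y z hy hz h =>
    (hφ.2.1.le_iff_le hy hz).1 h
  obtain ⟨ρ, hρ, H⟩ := exists_classKInf_of_sets (fun r => {y | 0 ≤ y ∧ φ y ≤ κ r})
    (fun r r' hr hrr' y hy => ⟨hy.1, hy.2.trans (hκ.mono hr hrr')⟩)
    (fun r _ => by
      obtain ⟨z, hz, hzr⟩ := hφ.2.2.2 (κ r)
      exact ⟨z, fun y hy => hle y z hy.1 hz (hy.2.trans hzr)⟩)
    (fun ε hε => by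
      obtain ⟨δ, hδ, h⟩ := exists_pos_forall_le_of_continuousOn hκ.1 hκ.2.2.1 (hφ.pos hε)
      exact ⟨δ, hδ, fun y hy => hle y ε hy.1 hε.le (hy.2.trans (h δ hδ.le le_rfl))⟩)
  exact ⟨ρ, hρ, fun r y hr hy h => H r hr y ⟨hy, h⟩⟩

/-- A class `KL` function dominating all `y` which satisfy `φ y ≤ κ r` and whose value `φ y` decays
at rate `c` in the coordinate `ψ`. -/
lemma exists_classKL_of_le_comp {φ κ ψ : ℝ → ℝ} (hφ : ClassKInf φ) (hκ : ClassKInf κ)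
    (hψ : StrictMonoOn ψ (Ioi 0)) {c K : ℝ} (hc : 0 < c) :
    ∃ β : ℝ → ℝ → ℝ, ClassKL β ∧ ∀ r s y : ℝ, 0 ≤ r → 0 ≤ s → 0 ≤ y → φ y ≤ κ r →
      (0 < φ y → ψ (φ y) ≤ ψ (κ r) + K - c * s) → y ≤ β r s := by
  have hle : ∀ y z : ℝ, 0 ≤ y → 0 ≤ z → φ y ≤ φ z → y ≤ z := fun y z hy hz h =>
    (hφ.2.1.le_iff_le hy hz).1 h
  obtain ⟨β, hβ, H⟩ := exists_classKL_of_sets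
    (fun r s => {y | 0 ≤ y ∧ φ y ≤ κ r ∧ (0 < φ y → ψ (φ y) ≤ ψ (κ r) + K - c * s)})
    (fun r r' s s' hr hrr' _ hs y hy => by
      have hκ' := hκ.mono hr hrr'
      refine ⟨hy.1, hy.2.1.trans hκ', fun hpos => (hy.2.2 hpos).trans ?_⟩
      have h1 : 0 < κ r := hpos.trans_le hy.2.1
      have h2 := hψ.monotoneOn h1 (h1.trans_le hκ') hκ'
      have h3 := mul_le_mul_of_nonneg_left hs hc.le
      linarith)
    (fun r _ => by
      obtain ⟨z, hz, hzr⟩ := hφ.2.2.2 (κ r)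
      exact ⟨z, fun y hy => hle y z hy.1 hz (hy.2.1.trans hzr)⟩)
    (fun ε hε => by
      obtain ⟨δ, hδ, h⟩ := exists_pos_forall_le_of_continuousOn hκ.1 hκ.2.2.1 (hφ.pos hε)
      exact ⟨δ, hδ, fun y hy => hle y ε hy.1 hε.le (hy.2.1.trans (h δ hδ.le le_rfl))⟩)
    (fun r ε _ hε => by
      refine ⟨max 0 ((ψ (κ r) + K - ψ (φ ε)) / c), le_max_left _ _, fun y hy => ?_⟩
      by_contra! hlt
      have h1 : φ ε < φ y := hφ.2.1 hε.le hy.1 hlt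
      have h2 := hφ.pos hε
      have h3 := hψ h2 (h2.trans h1) h1
      have h4 := hy.2.2 (h2.trans h1)
      have h5 := le_max_right 0 ((ψ (κ r) + K - ψ (φ ε)) / c)
      rw [div_le_iff₀ hc] at h5
      linarith)
  exact ⟨β, hβ, fun r s y hr hs hy h1 h2 => H r s hr hs y ⟨hy, h1, h2⟩⟩

end Comparison

lemma IsImpulseSeq.exists_Ioc_inter_eq_empty {γ : Set ℝ} (hγ : IsImpulseSeq γ) {a σ : ℝ}
    (ha : a < σ) (hσ : σ ∉ γ) : ∃ b, a ≤ b ∧ b < σ ∧ Ioc b σ ∩ γ = ∅ := by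
  have hc : (γ ∩ Iic σ)ᶜ ∈ nhds σ := (hγ.2 σ).isClosed.isOpen_compl.mem_nhds fun h => hσ h.1
  obtain ⟨l, ⟨hal, hlσ⟩, hl⟩ := exists_Ioc_subset_of_mem_nhds' hc ha
  exact ⟨l, hal, hlσ, eq_empty_iff_forall_notMem.2 fun s hs => hl hs.1 ⟨hs.2, hs.1.2⟩⟩

lemma IsImpulseSeq.exists_Ioo_inter_eq_empty {γ : Set ℝ} (hγ : IsImpulseSeq γ) (b : ℝ) :
    ∃ b', b < b' ∧ Ioo b b' ∩ γ = ∅ := by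
  have hc : (γ ∩ Ioc b (b + 1))ᶜ ∈ nhds b :=
    (hγ.finite_of_subset_Iic Ioc_subset_Iic_self).isClosed.isOpen_compl.mem_nhds
      fun h => lt_irrefl _ h.2.1
  obtain ⟨l, ⟨hbl, hl1⟩, hl⟩ := exists_Ico_subset_of_mem_nhds' hc (lt_add_one b)
  exact ⟨l, hbl, eq_empty_iff_forall_notMem.2 fun s hs =>
    hl ⟨hs.1.1.le, hs.1.2⟩ ⟨hs.2, hs.1.1, hs.1.2.le.trans hl1⟩⟩

lemma jump_bound_of_flow_bound {γ : Set ℝ} {v p φ α : ℝ → ℝ} {R S a τ L : ℝ}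
    (hφ : PosDef φ) (hα : PosDef α) (hp : ∀ a b, IntervalIntegrable p volume a b) (hR : 0 ≤ R)
    (hS : ∀ r, 0 < r → invPrimitive φ (α r) ≤ invPrimitive φ r + S)
    (hflow : ∀ b, a ≤ b → Ioc a b ∩ γ = ∅ → b < τ → v b ≤ v a ∧
      (0 < v a → invPrimitive φ (v b) ≤ invPrimitive φ (v a) - ∫ s in a..b, p s))
    (hL : Tendsto v (nhdsWithin τ (Iio τ)) (nhds L)) (hjump : R ≤ L → v τ ≤ α L)
    (haτ : a < τ) (hγ : Ioo a τ ∩ γ = ∅) (hgt : ∀ s ∈ Ioc a τ, R < v s) :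
    0 < v a ∧ invPrimitive φ (v τ) ≤ invPrimitive φ (v a) - (∫ s in a..τ, p s) + S ∧
      0 < L ∧ L ≤ v a ∧ v τ ≤ α L := by
  have hnear : ∀ᶠ b in nhdsWithin τ (Iio τ), b ∈ Ioo a τ := Ioo_mem_nhdsLT haτ
  have hfl : ∀ b ∈ Ioo a τ, v b ≤ v a ∧
      (0 < v a → invPrimitive φ (v b) ≤ invPrimitive φ (v a) - ∫ s in a..b, p s) := fun b hb =>
    hflow b hb.1.le (subset_empty_iff.1 <| hγ ▸
      inter_subset_inter_left _ fun s hs => ⟨hs.1, hs.2.trans_lt hb.2⟩) hb.2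
  have hRL : R ≤ L := ge_of_tendsto hL (hnear.mono fun b hb => (hgt b ⟨hb.1, hb.2.le⟩).le)
  have hLa : L ≤ v a := le_of_tendsto hL (hnear.mono fun b hb => (hfl b hb).1)
  have hvα := hjump hRL
  have hvτ : 0 < v τ := hR.trans_lt (hgt τ ⟨haτ, le_rfl⟩)
  have hLpos : 0 < L := by
    rcases (hR.trans hRL).eq_or_lt with h | h
    · rw [← h, hα.2.1] at hvα
      linarith
    · exact h
  have hva : 0 < v a := hLpos.trans_le hLa
  have hψL : invPrimitive φ L ≤ invPrimitive φ (v a) - ∫ s in a..τ, p s := by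
    have h1 : Tendsto (fun b => invPrimitive φ (v b)) (nhdsWithin τ (Iio τ))
        (nhds (invPrimitive φ L)) := (hφ.continuousAt_invPrimitive hLpos).tendsto.comp hL
    have h2 : Tendsto (fun b => invPrimitive φ (v a) - ∫ s in a..b, p s)
        (nhdsWithin τ (Iio τ)) (nhds (invPrimitive φ (v a) - ∫ s in a..τ, p s)) :=
      tendsto_const_nhds.sub
        (((intervalIntegral.continuous_primitive hp a).tendsto τ).mono_left nhdsWithin_le_nhds)
    exact le_of_tendsto_of_tendsto h1 h2 (hnear.mono fun b hb => (hfl b hb).2 hva)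
  have hψ : invPrimitive φ (v τ) ≤ invPrimitive φ (α L) :=
    hφ.strictMonoOn_invPrimitive.monotoneOn hvτ (hα.2.2 L hLpos) hvα
  exact ⟨hva, by linarith [hS L hLpos], hLpos, hLa, hvα⟩

lemma le_of_forall_mem_Ioc_lt {γ : Set ℝ} {v p φ α B : ℝ → ℝ} {R S M θ σ t : ℝ}
    (hφ : PosDef φ) (hα : PosDef α) (hp : ∀ a b, IntervalIntegrable p volume a b)
    (hpnn : ∀ t, 0 ≤ t → 0 ≤ p t) (hθ : 0 < θ) (hS0 : 0 ≤ S) (hSM : S ≤ M)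
    (hM : ∀ t, 0 ≤ t → M ≤ ∫ s in t..(t + θ), p s) (hγ : IsImpulseSeq γ)
    (hsep : ∀ s ∈ γ, ∀ t ∈ γ, s < t → θ ≤ t - s) (hR : 0 ≤ R)
    (hS : ∀ r, 0 < r → invPrimitive φ (α r) ≤ invPrimitive φ r + S)
    (hB : ∀ r, 0 ≤ r → r ≤ B r ∧ ∀ a, 0 ≤ a → a ≤ r → α a ≤ B r)
    (hσ : 0 ≤ σ) (hσt : σ ≤ t) (hv : 0 ≤ v σ)
    (hflow : ∀ a b, σ ≤ a → a ≤ b → b ≤ t → Ioc a b ∩ γ = ∅ → (∀ s ∈ Ioc a b, R < v s) →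
      v b ≤ v a ∧
      (0 < v a → invPrimitive φ (v b) ≤ invPrimitive φ (v a) - ∫ s in a..b, p s))
    (hjump : ∀ τ ∈ γ, σ < τ → τ ≤ t → ∃ L, Tendsto v (nhdsWithin τ (Iio τ)) (nhds L) ∧
      (R ≤ L → v τ ≤ α L))
    (hgt : ∀ s ∈ Ioc σ t, R < v s) :
    v t ≤ B (v σ) ∧ (0 < v t → invPrimitive φ (v t) ≤
      invPrimitive φ (v σ) - (M - S) / (2 * θ) * (t - σ) + 3 * M) := by
  have hM0 : 0 ≤ M := hS0.trans hSM
  rcases hσt.eq_or_lt with rfl | hlt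
  · exact ⟨(hB _ hv).1, fun _ => by linarith⟩
  have hJ : ∀ a τ, σ ≤ a → a < τ → τ ≤ t → τ ∈ γ → Ioo a τ ∩ γ = ∅ →
      0 < v a ∧ invPrimitive φ (v τ) ≤ invPrimitive φ (v a) - (∫ s in a..τ, p s) + S ∧
      ∃ L, 0 < L ∧ L ≤ v a ∧ v τ ≤ α L := by
    intro a τ ha haτ hτt hτ hemp
    obtain ⟨L, hL, hj⟩ := hjump τ hτ (ha.trans_lt haτ) hτt
    obtain ⟨h1, h2, h3⟩ := jump_bound_of_flow_bound hφ hα hp hR hS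
      (fun b hab hb hbτ => hflow a b ha hab (hbτ.le.trans hτt) hb fun s hs =>
        hgt s ⟨ha.trans_lt hs.1, hs.2.trans (hbτ.le.trans hτt)⟩) hL hj haτ hemp
      fun s hs => hgt s ⟨ha.trans_lt hs.1, hs.2.trans hτt⟩
    exact ⟨h1, h2, L, h3⟩
  have hvσ : 0 < v σ := by
    by_cases hemp : Ioc σ t ∩ γ = ∅
    · exact (hR.trans_lt (hgt t ⟨hlt, le_rfl⟩)).trans_le
        (hflow σ t le_rfl hσt le_rfl hemp hgt).1
    · have hfin : (γ ∩ Ioc σ t).Finite := hγ.finite_of_subset_Iic fun s hs => hs.2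
      obtain ⟨τ, hτ, hmin⟩ := exists_min_image _ id hfin
        (inter_comm _ _ ▸ nonempty_iff_ne_empty.2 hemp)
      refine (hJ σ τ le_rfl hτ.2.1 hτ.2.2 hτ.1 (eq_empty_iff_forall_notMem.2 ?_)).1
      rintro s ⟨hs1, hs2⟩
      exact absurd (hmin s ⟨hs2, hs1.1, hs1.2.le.trans hτ.2.2⟩) (not_le.2 hs1.2)
  have hpos : ∀ s, σ ≤ s → s ≤ t → 0 < v s := fun s h1 h2 => by
    rcases h1.eq_or_lt with rfl | h1
    · exact hvσ
    · exact hR.trans_lt (hgt s ⟨h1, h2⟩)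
  have hc : 0 ≤ (M - S) / (2 * θ) := div_nonneg (by linarith) (by linarith)
  obtain ⟨h1, h2⟩ := impulse_decay (w := fun s => invPrimitive φ (v s))
    (q := fun a b => ∫ s in a..b, p s) (t := t) (σ := σ) hγ hsep hc hM0 hSM
    (fun a b ha hab => intervalIntegral.integral_nonneg hab fun s hs =>
      hpnn s (hσ.trans (ha.trans hs.1)))
    (fun a b ha hab => rate_mul_sub_le_integral hp hpnn hθ hS0 hSM hM (hσ.trans ha) hab)
    (fun a b ha hab => add_rate_mul_le_integral hp hpnn hθ hS0 hSM hM (hσ.trans ha) hab)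
    (fun a b ha hab hbt hemp => (hflow a b ha hab hbt hemp fun s hs =>
      hgt s ⟨ha.trans_lt hs.1, hs.2.trans hbt⟩).2 (hpos a ha (hab.trans hbt)))
    (fun a τ ha haτ hτt hτ hemp => (hJ a τ ha haτ hτt hτ hemp).2.1) hσt
  refine ⟨?_, fun _ => h1⟩
  rcases h2 with hemp | ⟨τ, hτ, hστ, hτt, hemp, hle⟩
  · exact (hflow σ t le_rfl hσt le_rfl hemp hgt).1.trans (hB _ hv).1
  · obtain ⟨-, -, L, hL0, hLσ, hvL⟩ := hJ σ τ le_rfl hστ hτt hτ hemp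
    have := (hφ.strictMonoOn_invPrimitive.le_iff_le (hpos t hσt le_rfl)
      (hpos τ hστ.le hτt)).1 hle
    exact this.trans (hvL.trans ((hB _ hv).2 L hL0.le hLσ))

/-- Restarting at the last time at which `v` is at most `R` gives either an ultimate bound
in terms of `R` or a decay estimate on the whole interval. -/
lemma le_or_decay {γ : Set ℝ} {v p φ α B : ℝ → ℝ} {R S M θ t₀ t : ℝ}
    (hφ : PosDef φ) (hα : PosDef α) (hp : ∀ a b, IntervalIntegrable p volume a b)
    (hpnn : ∀ t, 0 ≤ t → 0 ≤ p t) (hθ : 0 < θ) (hS0 : 0 ≤ S) (hSM : S ≤ M)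
    (hM : ∀ t, 0 ≤ t → M ≤ ∫ s in t..(t + θ), p s) (hγ : IsImpulseSeq γ)
    (hsep : ∀ s ∈ γ, ∀ t ∈ γ, s < t → θ ≤ t - s) (hR : 0 ≤ R)
    (hS : ∀ r, 0 < r → invPrimitive φ (α r) ≤ invPrimitive φ r + S) (hBK : ClassKInf B)
    (hB : ∀ r, 0 ≤ r → r ≤ B r ∧ ∀ a, 0 ≤ a → a ≤ r → α a ≤ B r)
    (ht₀ : 0 ≤ t₀) (ht : t₀ ≤ t) (hv : ∀ s, t₀ ≤ s → s ≤ t → 0 ≤ v s)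
    (hcont : ∀ a b, t₀ ≤ a → a ≤ b → b ≤ t → Ioc a b ∩ γ = ∅ → ContinuousOn v (Icc a b))
    (hflow : ∀ a b, t₀ ≤ a → a ≤ b → b ≤ t → Ioc a b ∩ γ = ∅ → (∀ s ∈ Ioc a b, R < v s) →
      v b ≤ v a ∧
      (0 < v a → invPrimitive φ (v b) ≤ invPrimitive φ (v a) - ∫ s in a..b, p s))
    (hjump : ∀ τ ∈ γ, t₀ < τ → τ ≤ t → ∃ L, Tendsto v (nhdsWithin τ (Iio τ)) (nhds L) ∧
      (R ≤ L → v τ ≤ α L) ∧ (L ≤ R → v τ ≤ B R)) :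
    v t ≤ B (B R) ∨ (v t ≤ B (v t₀) ∧ (0 < v t → invPrimitive φ (v t) ≤
      invPrimitive φ (v t₀) - (M - S) / (2 * θ) * (t - t₀) + 3 * M)) := by
  by_cases hW : ∀ s ∈ Ioc t₀ t, R < v s
  · exact Or.inr <| le_of_forall_mem_Ioc_lt hφ hα hp hpnn hθ hS0 hSM hM hγ hsep hR hS hB ht₀ ht
      (hv _ le_rfl ht) hflow
      (fun τ h1 h2 h3 => (hjump τ h1 h2 h3).imp fun L hL => ⟨hL.1, hL.2.1⟩) hW
  left
  push Not at hW
  obtain ⟨s₀, hs₀, hvs₀⟩ := hW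
  set W := {s | s ∈ Icc t₀ t ∧ v s ≤ R}
  have hne : W.Nonempty := ⟨s₀, ⟨hs₀.1.le, hs₀.2⟩, hvs₀⟩
  have hbd : BddAbove W := ⟨t, fun s hs => hs.1.2⟩
  set σ := sSup W with hσdef
  have hs₀σ : s₀ ≤ σ := le_csSup hbd ⟨⟨hs₀.1.le, hs₀.2⟩, hvs₀⟩
  have hσ0 : t₀ < σ := hs₀.1.trans_le hs₀σ
  have hσt : σ ≤ t := csSup_le hne fun s hs => hs.1.2
  have hgt : ∀ s ∈ Ioc σ t, R < v s := fun s hs => by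
    by_contra hcon
    exact absurd (le_csSup hbd (show s ∈ W from ⟨⟨hσ0.le.trans hs.1.le, hs.2⟩, not_lt.1 hcon⟩))
      (not_le.2 hs.1)
  have hvσ : v σ ≤ B R := by
    by_cases hσW : σ ∈ W
    · exact hσW.2.trans (hB R hR).1
    have hfreq : ∃ᶠ s in nhdsWithin σ (Iio σ), s ∈ Icc t₀ t ∧ v s ≤ R := by
      rw [frequently_nhdsWithin_iff]
      have := (isLUB_csSup hne hbd).frequently_nhds_mem hne
      refine this.mono fun s hs => ⟨hs, ?_⟩
      refine lt_of_le_of_ne (le_csSup hbd hs) fun h => hσW ?_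
      rwa [hσdef, ← h]
    by_cases hσγ : σ ∈ γ
    · obtain ⟨L, hL, -, h2⟩ := hjump σ hσγ hσ0 hσt
      exact h2 (le_of_tendsto_of_frequently hL (hfreq.mono fun s hs => hs.2))
    · obtain ⟨a, ha1, ha2, ha3⟩ := hγ.exists_Ioc_inter_eq_empty hσ0 hσγ
      have hc := (hcont a σ ha1 ha2.le hσt ha3) σ ⟨ha2.le, le_rfl⟩
      have hL : Tendsto v (nhdsWithin σ (Iio σ)) (nhds (v σ)) :=
        hc.tendsto.mono_left (nhdsWithin_le_of_mem
          (mem_of_superset (Ioo_mem_nhdsLT ha2) Ioo_subset_Icc_self))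
      exact (le_of_tendsto_of_frequently hL (hfreq.mono fun s hs => hs.2)).trans (hB R hR).1
  have hvσ0 := hv σ hσ0.le hσt
  refine (le_of_forall_mem_Ioc_lt hφ hα hp hpnn hθ hS0 hSM hM hγ hsep hR hS hB
    (ht₀.trans hσ0.le) hσt hvσ0 (fun a b ha => hflow a b (hσ0.le.trans ha))
    (fun τ h1 h2 h3 => (hjump τ h1 (hσ0.trans h2) h3).imp fun L hL => ⟨hL.1, hL.2.1⟩)
    hgt).1.trans ?_
  exact hBK.mono hvσ0 hvσ

lemma inputNorm_nonneg {m : ℕ} (γ : Set ℝ) (u : ℝ → Stt m) (I : Set ℝ) : 0 ≤ inputNorm γ u I := by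
  refine le_max_of_le_right (Real.sSup_nonneg ?_)
  rintro _ ⟨s, -, rfl⟩
  exact norm_nonneg _

lemma IsInput.ae_norm_le_inputNorm {m : ℕ} {u : ℝ → Stt m} (hu : IsInput u) (γ : Set ℝ)
    {a b : ℝ} (ha : 0 ≤ a) : ∀ᵐ s, s ∈ Ioc a b → ‖u s‖ ≤ inputNorm γ u (Ioc a b) := by
  obtain ⟨C, hC⟩ := hu.2 b
  have hbd : ∀ᵐ s ∂(volume.restrict (Ioc a b)), ‖u s‖ ≤ C := by
    rw [ae_restrict_iff' measurableSet_Ioc]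
    filter_upwards [hC] with s hs hmem
    exact hs ⟨ha.trans hmem.1.le, hmem.2⟩
  have := ae_le_essSup (μ := volume.restrict (Ioc a b)) (f := fun s => ‖u s‖) ⟨C, hbd⟩
  rw [ae_restrict_iff' measurableSet_Ioc] at this
  filter_upwards [this] with s hs hmem
  exact (hs hmem).trans (le_max_left _ _)

lemma IsImpulseSeq.norm_le_inputNorm {m : ℕ} {γ : Set ℝ} (hγ : IsImpulseSeq γ) (u : ℝ → Stt m)
    {a b τ : ℝ} (hτ : τ ∈ γ) (hab : τ ∈ Ioc a b) : ‖u τ‖ ≤ inputNorm γ u (Ioc a b) :=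
  (le_csSup ((hγ.finite_of_subset_Iic Ioc_subset_Iic_self).image fun t => ‖u t‖).bddAbove
    ⟨τ, ⟨hτ, hab⟩, rfl⟩).trans (le_max_right _ _)

section Solution

variable {n m : ℕ} {γ : Set ℝ} {f g : ℝ → Stt n → Stt m → Stt n} {t₀ : ℝ} {x₀ : Stt n}
  {u : ℝ → Stt m} {T : EReal} {x : ℝ → Stt n} {V Vm : ℝ → Stt n → ℝ}

lemma IsSolution.intervalIntegrable (hx : IsSolution γ f g t₀ x₀ u T x) {a b : ℝ} (ha : t₀ ≤ a)
    (hab : a ≤ b) (hb : (b : EReal) < T) (hemp : Ioc a b ∩ γ = ∅) :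
    IntervalIntegrable (fun s => f s (x s) (u s)) volume a b :=
  (intervalIntegrable_iff_integrableOn_Icc_of_le hab).2 (hx.flow a b ha hab hb hemp).1

lemma IsSolution.eq_add_integral (hx : IsSolution γ f g t₀ x₀ u T x) {a b : ℝ} (ha : t₀ ≤ a)
    (hb : (b : EReal) < T) (hemp : Ioc a b ∩ γ = ∅) :
    ∀ s ∈ Icc a b, x s = x a + ∫ r in a..s, f r (x r) (u r) := fun s hs =>
  (hx.flow a s ha hs.1 (lt_of_le_of_lt (EReal.coe_le_coe_iff.2 hs.2) hb)
    (subset_empty_iff.1 <| hemp ▸ inter_subset_inter_left _ (Ioc_subset_Ioc_right hs.2))).2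

lemma IsImpulseSeq.exists_locLipschitzOn (hγ : IsImpulseSeq γ) (hV : InClassV γ V Vm) {a b : ℝ}
    (ha : 0 ≤ a) (hemp : Ioc a b ∩ γ = ∅) : ∃ b', b < b' ∧
      LocLipschitzOn (Ico a b' ×ˢ (univ : Set (Stt n))) fun q : ℝ × Stt n => V q.1 q.2 := by
  obtain ⟨b', hb, hb'⟩ := hγ.exists_Ioo_inter_eq_empty b
  refine ⟨b', hb, hV.1 a b' ha (eq_empty_iff_forall_notMem.2 fun s hs => ?_)⟩
  rcases le_or_gt s b with h | h
  · exact eq_empty_iff_forall_notMem.1 hemp s ⟨⟨hs.1.1, h⟩, hs.2⟩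
  · exact eq_empty_iff_forall_notMem.1 hb' s ⟨⟨h, hs.1.2⟩, hs.2⟩

lemma IsSolution.absolutelyContinuousOnInterval (hx : IsSolution γ f g t₀ x₀ u T x)
    (hγ : IsImpulseSeq γ) (hV : InClassV γ V Vm) {a b : ℝ} (ht₀ : 0 ≤ t₀) (ha : t₀ ≤ a)
    (hab : a ≤ b) (hb : (b : EReal) < T) (hemp : Ioc a b ∩ γ = ∅) :
    AbsolutelyContinuousOnInterval (fun s => V s (x s)) a b := by
  obtain ⟨b', hbb', hL⟩ := hγ.exists_locLipschitzOn hV (ht₀.trans ha) hemp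
  exact absolutelyContinuousOnInterval_comp_integral hab (hx.intervalIntegrable ha hab hb hemp)
    (hx.eq_add_integral ha hb hemp) hL fun s hs => ⟨⟨hs.1, hs.2.trans_lt hbb'⟩, mem_univ _⟩

lemma IsSolution.ae_deriv_eq_diniAlong (hx : IsSolution γ f g t₀ x₀ u T x)
    (hγ : IsImpulseSeq γ) (hV : InClassV γ V Vm) {a b : ℝ} (ht₀ : 0 ≤ t₀) (ha : t₀ ≤ a)
    (hab : a ≤ b) (hb : (b : EReal) < T) (hemp : Ioc a b ∩ γ = ∅) :
    ∀ᵐ s, s ∈ Ioc a b →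
      deriv (fun r => V r (x r)) s = DiniAlong f V s (x s) (u s) := by
  obtain ⟨b', hbb', hL⟩ := hγ.exists_locLipschitzOn hV (ht₀.trans ha) hemp
  have hne : ∀ᵐ s : ℝ, s ≠ b := by simp [ae_iff, measure_singleton]
  filter_upwards [(hx.intervalIntegrable ha hab hb hemp).ae_hasDerivAt_integral,
    (hx.absolutelyContinuousOnInterval hγ hV ht₀ ha hab hb hemp).ae_differentiableAt, hne]
    with s h1 h2 h3 hs
  have hsu : s ∈ uIcc a b := uIcc_of_le hab ▸ ⟨hs.1.le, hs.2⟩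
  have hxd : HasDerivAt x (f s (x s) (u s)) s := by
    refine ((h1 hsu a left_mem_uIcc).const_add (x a)).congr_of_eventuallyEq ?_
    filter_upwards [Ioo_mem_nhds hs.1 (lt_of_le_of_ne hs.2 h3)] with r hr
    exact hx.eq_add_integral ha hb hemp r ⟨hr.1.le, hr.2.le⟩
  exact (diniAlong_eq_of_hasDerivAt ⟨hs.1.le, hs.2.trans_lt hbb'⟩ hL hxd
    (h2 hsu).hasDerivAt).symm

lemma IsSolution.exists_tendsto_left (hx : IsSolution γ f g t₀ x₀ u T x) (hV : InClassV γ V Vm)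
    {τ : ℝ} (hτ : τ ∈ γ) (h0 : t₀ < τ) (hT : (τ : EReal) < T) :
    ∃ ξ, Tendsto (fun s => V s (x s)) (nhdsWithin τ (Iio τ)) (nhds (Vm τ ξ)) ∧
      x τ = ξ + g τ ξ (u τ) := by
  obtain ⟨ξ, hξ, hj⟩ := hx.jump τ hτ h0 hT
  refine ⟨ξ, (hV.2 τ hτ ξ).comp (f := fun s => (s, x s)) ?_, hj⟩
  refine tendsto_nhdsWithin_iff.2 ⟨?_, ?_⟩
  · exact (tendsto_id.mono_left nhdsWithin_le_nhds).prodMk_nhds hξ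
  · filter_upwards [self_mem_nhdsWithin] with s hs using ⟨hs, mem_univ _⟩

end Solution

/-- Theorem 4(a): strong `(h⁰,h)`-ISS under a minimum dwell time, with
stabilizing nonlinear continuous dynamics. -/
theorem stmt8 {n m : ℕ} {Λ : Type*} (γ : Λ → Set ℝ)
    (f g : Λ → ℝ → Stt n → Stt m → Stt n)
    (hγ : ∀ l : Λ, IsImpulseSeq (γ l))
    (h0 h : ℝ → Stt n → ℝ)
    (hh0 : ∀ (t : ℝ) (ξ : Stt n), 0 ≤ t → 0 ≤ h0 t ξ)
    (hh : ∀ (t : ℝ) (ξ : Stt n), 0 ≤ t → 0 ≤ h t ξ)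
    (V Vm : Λ → ℝ → Stt n → ℝ) (φ1 φ2 χ π : ℝ → ℝ)
    (p φb αb : ℝ → ℝ)
    (hp : LocIntegrable p) (hpnn : ∀ t : ℝ, 0 ≤ t → 0 ≤ p t)
    (hφbc : ContinuousOn φb (Set.Ici 0)) (hαb : PosDef αb)
    (hA1 : Assumption1 γ f g h0 h V Vm φ1 φ2 χ π
      (fun _ t r => p t * φb r) (fun _ _ r => αb r))
    (hφbpd : PosDef φb)
    (θ : ℝ) (hθ : 0 < θ)
    (hΓθ : ∀ l : Λ, (∀ s ∈ γ l, θ ≤ s) ∧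
      ∀ s ∈ γ l, ∀ t ∈ γ l, s < t → θ ≤ t - s)
    (M : ℝ) (hM : M = sInf ((fun t => ∫ s in t..(t + θ), p s) '' Set.Ici 0))
    (hMpos : 0 < M)
    (hbdd : BddAbove ((fun a => ∫ s in a..(αb a), (φb s)⁻¹) '' Set.Ioi 0))
    (hlt : sSup ((fun a => ∫ s in a..(αb a), (φb s)⁻¹) '' Set.Ioi 0) < M) :
    StronglyISS γ f g h0 h := by
  obtain ⟨hφ1, hφ2, hχ, hπ, hV, -, -, hbounds, hdini, hjump₁, hjump₂⟩ := hA1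
  have hpint : ∀ a b, IntervalIntegrable p volume a b := fun a b =>
    (hp (min a b) (max a b)).intervalIntegrable
  have hMle : ∀ t, 0 ≤ t → M ≤ ∫ s in t..(t + θ), p s := fun t ht => by
    rw [hM]
    refine csInf_le ⟨0, ?_⟩ ⟨t, ht, rfl⟩
    rintro _ ⟨r, hr, rfl⟩
    exact intervalIntegral.integral_nonneg (by linarith) fun s hs =>
      hpnn s (le_trans hr hs.1)
  set S := max (sSup ((fun a => ∫ s in a..(αb a), (φb s)⁻¹) '' Ioi 0)) 0
  have hS0 : 0 ≤ S := le_max_right _ _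
  have hSM : S < M := max_lt hlt hMpos
  have hSψ : ∀ r, 0 < r → invPrimitive φb (αb r) ≤ invPrimitive φb r + S := fun r hr => by
    have h1 : ∫ s in r..(αb r), (φb s)⁻¹ ≤ S :=
      (le_csSup hbdd ⟨r, hr, rfl⟩).trans (le_max_left _ _)
    linarith [hφbpd.invPrimitive_sub hr (hαb.2.2 r hr)]
  obtain ⟨B, hBK, hB⟩ := exists_classKInf_dominating hαb.1 hαb.2.1
  set c := (M - S) / (2 * θ)
  have hc : 0 < c := div_pos (by linarith) (by linarith)
  set c' := c * θ / (θ + 1) with hc'def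
  have hc' : 0 < c' := by positivity
  obtain ⟨β, hβ, hβle⟩ := exists_classKL_of_le_comp hφ1 (hBK.comp hφ2)
    hφbpd.strictMonoOn_invPrimitive hc' (K := 3 * M + c')
  obtain ⟨ρ, hρ, hρle⟩ := exists_classKInf_of_le_comp hφ1 (hBK.comp (hBK.comp (hχ.add hπ)))
  refine ⟨β, ρ, hβ, hρ, fun l t₀ x₀ u T x ht₀ hu hmax t ht htT => ?_⟩
  have hx := hmax.1
  set U := inputNorm (γ l) u (Ioc t₀ t)
  have hU : 0 ≤ U := inputNorm_nonneg _ _ _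
  have hχU := hχ.nonneg hU
  have hπU := hπ.nonneg hU
  have hlt_T : ∀ s, s ≤ t → (s : EReal) < T := fun s hs =>
    lt_of_le_of_lt (EReal.coe_le_coe_iff.2 hs) htT
  have hvnn : ∀ s, 0 ≤ s → 0 ≤ V l s (x s) := fun s hs =>
    (hφ1.nonneg (hh s _ hs)).trans (hbounds l s _ hs).1
  have hac : ∀ a b, t₀ ≤ a → a ≤ b → b ≤ t → Ioc a b ∩ γ l = ∅ →
      AbsolutelyContinuousOnInterval (fun s => V l s (x s)) a b := fun a b ha hab hbt hemp =>
    hx.absolutelyContinuousOnInterval (hγ l) (hV l) ht₀ ha hab (hlt_T b hbt) hemp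
  have key := le_or_decay (v := fun s => V l s (x s)) (t₀ := t₀) (t := t) (R := χ U + π U)
    hφbpd hαb hpint hpnn hθ hS0 hSM.le hMle (hγ l) (hΓθ l).2 (by positivity) hSψ hBK hB ht₀ ht
    (fun s hs _ => hvnn s (ht₀.trans hs)) ?_ ?_ ?_
  · have ht0' : 0 ≤ t := ht₀.trans ht
    have hht := hh t (x t) ht0'
    have hVt := (hbounds l t (x t) ht0').1
    have hh00 := hh0 t₀ x₀ ht₀
    have hs : 0 ≤ t - t₀ + (nJumps (γ l) t₀ t : ℝ) := add_nonneg (by linarith) (by positivity)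
    rcases key with hR | ⟨hle, hdec⟩
    · have := hρle U (h t (x t)) hU hht (hVt.trans hR)
      linarith [(hβ.1 _ hs).nonneg hh00]
    · suffices h t (x t) ≤ β (h0 t₀ x₀) (t - t₀ + (nJumps (γ l) t₀ t : ℝ)) by
        linarith [hρ.nonneg hU]
      have hv0 : V l t₀ (x t₀) ≤ φ2 (h0 t₀ x₀) := hx.init ▸ (hbounds l t₀ (x t₀) ht₀).2
      have hv0nn := hvnn t₀ ht₀
      refine hβle _ _ _ hh00 hs hht (hVt.trans (hle.trans (hBK.mono hv0nn hv0))) fun hpos => ?_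
      have hvt : 0 < V l t (x t) := hpos.trans_le hVt
      have hv0pos : 0 < V l t₀ (x t₀) := by
        refine lt_of_le_of_ne hv0nn fun h0 => ?_
        rw [← h0, hBK.2.2.1] at hle
        linarith
      have hv0B : V l t₀ (x t₀) ≤ B (φ2 (h0 t₀ x₀)) := hv0.trans (hB _ (hv0nn.trans hv0)).1
      have hψ1 := hφbpd.strictMonoOn_invPrimitive.monotoneOn hpos hvt hVt
      have hψ2 := hφbpd.strictMonoOn_invPrimitive.monotoneOn hv0pos (hv0pos.trans_le hv0B) hv0B
      have hn := nJumps_le (hΓθ l).2 hθ ht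
      have hrate : c' * (t - t₀ + (nJumps (γ l) t₀ t : ℝ)) ≤ c * (t - t₀) + c' := by
        have hmul := mul_le_mul_of_nonneg_left hn hc'.le
        have heq : c' * (t - t₀) + c' * ((t - t₀) / θ + 1) = c * (t - t₀) + c' := by
          rw [hc'def]
          field_simp
          ring
        linarith
      linarith [hdec hvt]
  · intro a b ha hab hbt hemp
    simpa [uIcc_of_le hab] using (hac a b ha hab hbt hemp).continuousOn
  · intro a b ha hab hbt hemp hgt
    refine hφbpd.invPrimitive_le_of_deriv_le' hab (hpint a b)
      (fun s hs => hpnn s (ht₀.trans (ha.trans hs.1))) (hac a b ha hab hbt hemp)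
      (fun s hs => lt_of_le_of_lt (by positivity) (hgt s hs)) ?_
    filter_upwards [hx.ae_deriv_eq_diniAlong (hγ l) (hV l) ht₀ ha hab (hlt_T b hbt) hemp,
      hu.ae_norm_le_inputNorm (γ l) (b := t) ht₀] with s hs1 hs2 hs
    rw [hs1 hs]
    have hsU : ‖u s‖ ≤ U := hs2 ⟨ha.trans_lt hs.1, hs.2.trans hbt⟩
    refine hdini l s (x s) (u s) (ht₀.trans (ha.trans hs.1.le))
      (fun h => eq_empty_iff_forall_notMem.1 hemp s ⟨hs, h⟩) ?_
    linarith [hχ.mono (norm_nonneg _) hsU, hgt s hs]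
  · intro τ hτ h0τ hτt
    obtain ⟨ξ, hξ, hxτ⟩ := hx.exists_tendsto_left (hV l) hτ h0τ (hlt_T τ hτt)
    have hτU : ‖u τ‖ ≤ U := (hγ l).norm_le_inputNorm u hτ ⟨h0τ, hτt⟩
    have hχτ := hχ.mono (norm_nonneg _) hτU
    have hπτ := hπ.mono (norm_nonneg _) hτU
    have h1 := hjump₁ l τ ξ (u τ) hτ
    have h2 := hjump₂ l τ ξ (u τ) hτ
    rw [← hxτ] at h1 h2
    refine ⟨_, hξ, fun hR => h1 (by linarith), fun hR => ?_⟩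
    have hBR := hB (χ U + π U) (by positivity)
    rcases le_total (Vm l τ ξ) (χ ‖u τ‖) with h | h
    · exact (h2 h).trans (by linarith [hBR.1])
    · exact (h1 h).trans (hBR.2 _ ((hχ.nonneg (norm_nonneg _)).trans h) hR)

end
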